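/- arXiv:2504.00594 — 4 statements merged into one kernel-verified Lean document; each statement's English description precedes it below -/
import Mathlib

section
/- For |δ| < 1 and a, b > 0, define φ(δ,a,b) = P(Z_δ ∈ R_{a,b}) − P(Z_0 ∈ R_{a,b}). Then |φ(δ,a,b)| ≤ (1/(2π)) · (1/√(1−δ²)) · exp(−(a² + b²)/2) · exp( |δ| a b / (1−δ²) ) · |δ|. -/
open MeasureTheory

noncomputable section

/-- The density `ψ(t,x,y)` of the bivariate centered Gaussian vector `Z_t` with
covariance matrix `[[1, t], [t, 1]]`, for `|t| < 1`. -/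
def psi (t x y : ℝ) : ℝ :=
  (1 / (2 * Real.pi * Real.sqrt (1 - t ^ 2))) *
    Real.exp (-(x ^ 2 - 2 * t * x * y + y ^ 2) / (2 * (1 - t ^ 2)))

/-- `P(Z_δ ∈ R_{a,b})`, the probability that `Z_δ` lies in the quadrant
`R_{a,b} = [a,∞) × [b,∞)`, expressed via the density `ψ`. -/
def quadProb (δ a b : ℝ) : ℝ :=
  ∫ z : ℝ × ℝ in Set.Ici a ×ˢ Set.Ici b, psi δ z.1 z.2

theorem one_sub_sq_pos {t : ℝ} (ht : |t| < 1) : 0 < 1 - t ^ 2 := by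
  have := (sq_lt_one_iff_abs_lt_one t).2 ht
  linarith

theorem psi_pos {t : ℝ} (ht : |t| < 1) (x y : ℝ) : 0 < psi t x y := by
  have h := Real.sqrt_pos.2 (one_sub_sq_pos ht)
  unfold psi
  positivity

theorem psi_comm (t x y : ℝ) : psi t x y = psi t y x := by
  unfold psi
  ring_nf

theorem psi_le {t r : ℝ} (htr : |t| ≤ r) (hr : r < 1) (x y : ℝ) :
    psi t x y ≤ 1 / (2 * Real.pi * Real.sqrt (1 - r ^ 2)) * Real.exp (-(x ^ 2 + y ^ 2) / 4) := by
  have ht : 0 < 1 - t ^ 2 := one_sub_sq_pos (htr.trans_lt hr)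
  have hr0 : 0 ≤ r := (abs_nonneg t).trans htr
  have hr' : 0 < 1 - r ^ 2 := by nlinarith
  have hsq : t ^ 2 ≤ r ^ 2 := by rw [← sq_abs t]; gcongr
  have hs := Real.sqrt_pos.2 hr'
  unfold psi
  gcongr ?_ * Real.exp ?_
  · gcongr
  · rw [div_le_div_iff₀ (by linarith) (by norm_num)]
    nlinarith [mul_nonneg (sq_nonneg (1 - t)) (sq_nonneg (x + y)),
      mul_nonneg (sq_nonneg (1 + t)) (sq_nonneg (x - y))]

/-- A polynomial factor of degree two costs only half of the Gaussian decay rate of `psi`. -/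
theorem abs_mul_psi_le {t r M p x y : ℝ} (htr : |t| ≤ r) (hr : r < 1)
    (hp : |p| ≤ M * (1 + x ^ 2 + y ^ 2)) :
    |p * psi t x y| ≤ 8 * M / (2 * Real.pi * Real.sqrt (1 - r ^ 2)) *
      Real.exp (-(1 / 8) * x ^ 2) * Real.exp (-(1 / 8) * y ^ 2) := by
  have hpos : 0 < 1 + x ^ 2 + y ^ 2 := by positivity
  have hM : 0 ≤ M := nonneg_of_mul_nonneg_left ((abs_nonneg p).trans hp) hpos
  have hexp : 1 + x ^ 2 + y ^ 2 ≤ 8 * Real.exp ((x ^ 2 + y ^ 2) / 8) := by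
    have := Real.add_one_le_exp ((x ^ 2 + y ^ 2) / 8)
    linarith
  rw [abs_mul, abs_of_pos (psi_pos (htr.trans_lt hr) x y)]
  calc |p| * psi t x y
      ≤ (M * (8 * Real.exp ((x ^ 2 + y ^ 2) / 8))) *
        (1 / (2 * Real.pi * Real.sqrt (1 - r ^ 2)) * Real.exp (-(x ^ 2 + y ^ 2) / 4)) :=
        mul_le_mul (hp.trans (by gcongr)) (psi_le htr hr x y)
          (psi_pos (htr.trans_lt hr) x y).le (by positivity)
    _ = 8 * M / (2 * Real.pi * Real.sqrt (1 - r ^ 2)) *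
        (Real.exp ((x ^ 2 + y ^ 2) / 8) * Real.exp (-(x ^ 2 + y ^ 2) / 4)) := by ring
    _ = _ := by
        rw [mul_assoc _ (Real.exp _), ← Real.exp_add, ← Real.exp_add]
        ring_nf

/-- The mixed derivative `∂²ψ/∂x∂y`, which is also `∂ψ/∂t`. -/
def psiMixed (t x y : ℝ) : ℝ :=
  ((x - t * y) * (y - t * x) / (1 - t ^ 2) ^ 2 + t / (1 - t ^ 2)) * psi t x y

theorem hasDerivAt_psi_snd {t : ℝ} (ht : |t| < 1) (x y : ℝ) :
    HasDerivAt (fun y => psi t x y) (-(y - t * x) / (1 - t ^ 2) * psi t x y) y := by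
  have h := (one_sub_sq_pos ht).ne'
  have hd : HasDerivAt (fun y => -(x ^ 2 - 2 * t * x * y + y ^ 2) / (2 * (1 - t ^ 2)))
      (-(y - t * x) / (1 - t ^ 2)) y := by
    have := ((((hasDerivAt_id y).const_mul (2 * t * x)).const_sub (x ^ 2)).add
      ((hasDerivAt_id y).pow 2)).neg.div_const (2 * (1 - t ^ 2))
    refine this.congr_deriv ?_
    simp only [id]
    field_simp
    ring
  refine (hd.exp.const_mul _).congr_deriv ?_
  unfold psi
  ring

theorem hasDerivAt_psi_fst {t : ℝ} (ht : |t| < 1) (x y : ℝ) :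
    HasDerivAt (fun x => psi t x y) (-(x - t * y) / (1 - t ^ 2) * psi t x y) x := by
  simp_rw [fun x => psi_comm t x y]
  exact hasDerivAt_psi_snd ht y x

theorem hasDerivAt_deriv_psi {t : ℝ} (ht : |t| < 1) (x y : ℝ) :
    HasDerivAt (fun y => -(x - t * y) / (1 - t ^ 2) * psi t x y) (psiMixed t x y) y := by
  have h := (one_sub_sq_pos ht).ne'
  have hd : HasDerivAt (fun y => -(x - t * y) / (1 - t ^ 2)) (t / (1 - t ^ 2)) y := by
    have := (((hasDerivAt_id y).const_mul t).const_sub x).neg.div_const (1 - t ^ 2)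
    refine this.congr_deriv ?_
    ring
  refine (hd.mul (hasDerivAt_psi_snd ht x y)).congr_deriv ?_
  unfold psiMixed
  field_simp
  ring

theorem hasDerivAt_psi_corr {t : ℝ} (ht : |t| < 1) (x y : ℝ) :
    HasDerivAt (fun t => psi t x y) (psiMixed t x y) t := by
  have h0 := one_sub_sq_pos ht
  have h := h0.ne'
  have hs := (Real.sqrt_pos.2 h0).ne'
  have hsq := Real.sq_sqrt h0.le
  have hq : HasDerivAt (fun t : ℝ => 1 - t ^ 2) (-(2 * t)) t := by
    refine ((hasDerivAt_pow 2 t).const_sub 1).congr_deriv ?_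
    simp
  have h1 : HasDerivAt (fun t : ℝ => 1 / (2 * Real.pi * Real.sqrt (1 - t ^ 2)))
      (t / (1 - t ^ 2) * (1 / (2 * Real.pi * Real.sqrt (1 - t ^ 2)))) t := by
    have := (((hq.sqrt h).const_mul (2 * Real.pi)).inv (by positivity))
    simp_rw [one_div]
    refine this.congr_deriv ?_
    field_simp
    rw [hsq]
  have h2 : HasDerivAt (fun t => -(x ^ 2 - 2 * t * x * y + y ^ 2) / (2 * (1 - t ^ 2)))
      ((x - t * y) * (y - t * x) / (1 - t ^ 2) ^ 2) t := by
    have hn : HasDerivAt (fun t => -(x ^ 2 - 2 * t * x * y + y ^ 2)) (2 * x * y) t := by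
      have := (((((hasDerivAt_id t).const_mul 2).mul_const x).mul_const y).const_sub
        (x ^ 2)).add_const (y ^ 2) |>.neg
      refine this.congr_deriv ?_
      ring
    refine (hn.div (hq.const_mul 2) (by positivity)).congr_deriv ?_
    field_simp
    ring
  refine (h1.mul h2.exp).congr_deriv ?_
  unfold psiMixed psi
  ring

theorem abs_psiMixed_le {t r : ℝ} (htr : |t| ≤ r) (hr : r < 1) (x y : ℝ) :
    |psiMixed t x y| ≤ 8 * (2 / (1 - r ^ 2) ^ 2) / (2 * Real.pi * Real.sqrt (1 - r ^ 2)) *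
      Real.exp (-(1 / 8) * x ^ 2) * Real.exp (-(1 / 8) * y ^ 2) := by
  have ht1 : |t| ≤ 1 := htr.trans hr.le
  have ht : 0 < 1 - t ^ 2 := one_sub_sq_pos (htr.trans_lt hr)
  have hr0 : 0 < 1 - r ^ 2 := by nlinarith [(abs_nonneg t).trans htr]
  have hsq : t ^ 2 ≤ r ^ 2 := by rw [← sq_abs t]; gcongr
  refine abs_mul_psi_le htr hr ?_
  have hx : |x - t * y| ≤ |x| + |y| := (abs_sub _ _).trans <| by
    rw [abs_mul]; nlinarith [abs_nonneg y]
  have hy : |y - t * x| ≤ |x| + |y| := (abs_sub _ _).trans <| by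
    rw [abs_mul]; nlinarith [abs_nonneg x]
  have hnum : |(x - t * y) * (y - t * x)| ≤ 2 * (x ^ 2 + y ^ 2) := by
    rw [abs_mul]
    calc |x - t * y| * |y - t * x| ≤ (|x| + |y|) * (|x| + |y|) := by gcongr
      _ ≤ 2 * (x ^ 2 + y ^ 2) := by
        nlinarith [sq_abs x, sq_abs y, sq_nonneg (|x| - |y|)]
  calc |(x - t * y) * (y - t * x) / (1 - t ^ 2) ^ 2 + t / (1 - t ^ 2)|
      ≤ |(x - t * y) * (y - t * x)| / (1 - t ^ 2) ^ 2 + |t| / (1 - t ^ 2) := by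
        refine (abs_add_le _ _).trans_eq ?_
        rw [abs_div, abs_div, abs_of_pos ht, abs_of_pos (pow_pos ht 2)]
    _ ≤ 2 * (x ^ 2 + y ^ 2) / (1 - t ^ 2) ^ 2 + 1 / (1 - t ^ 2) ^ 2 := by
        gcongr
        nlinarith [sq_nonneg t]
    _ = (2 * (x ^ 2 + y ^ 2) + 1) / (1 - t ^ 2) ^ 2 := by ring
    _ ≤ 2 * (1 + x ^ 2 + y ^ 2) / (1 - r ^ 2) ^ 2 := by
        gcongr
        linarith
    _ = 2 / (1 - r ^ 2) ^ 2 * (1 + x ^ 2 + y ^ 2) := by ring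

theorem continuous_psi (t : ℝ) : Continuous fun z : ℝ × ℝ => psi t z.1 z.2 := by
  unfold psi
  fun_prop

theorem continuous_psiMixed (t : ℝ) : Continuous fun z : ℝ × ℝ => psiMixed t z.1 z.2 := by
  have := continuous_psi t
  unfold psiMixed
  fun_prop

theorem integrable_const_mul_exp_mul_exp (C : ℝ) : Integrable fun z : ℝ × ℝ =>
    C * Real.exp (-(1 / 8) * z.1 ^ 2) * Real.exp (-(1 / 8) * z.2 ^ 2) :=
  ((integrable_exp_neg_mul_sq (by norm_num : (0 : ℝ) < 1 / 8)).const_mul C).mul_prod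
    (integrable_exp_neg_mul_sq (by norm_num : (0 : ℝ) < 1 / 8))

theorem integrable_of_abs_le_gaussian {f : ℝ → ℝ} (hf : Continuous f) {C : ℝ}
    (h : ∀ x, |f x| ≤ C * Real.exp (-(1 / 8) * x ^ 2)) : Integrable f :=
  ((integrable_exp_neg_mul_sq (by norm_num : (0 : ℝ) < 1 / 8)).const_mul C).mono'
    hf.aestronglyMeasurable (ae_of_all _ h)

theorem abs_psi_le {t : ℝ} (ht : |t| < 1) (x y : ℝ) :
    |psi t x y| ≤ 8 * 1 / (2 * Real.pi * Real.sqrt (1 - |t| ^ 2)) *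
      Real.exp (-(1 / 8) * x ^ 2) * Real.exp (-(1 / 8) * y ^ 2) := by
  have h := abs_mul_psi_le (p := 1) (M := 1) (x := x) (y := y) le_rfl ht
    (by rw [abs_one]; nlinarith [sq_nonneg x, sq_nonneg y])
  rwa [one_mul] at h

theorem integrable_psi {t : ℝ} (ht : |t| < 1) :
    Integrable fun z : ℝ × ℝ => psi t z.1 z.2 :=
  (integrable_const_mul_exp_mul_exp _).mono' (continuous_psi t).aestronglyMeasurable
    (ae_of_all _ fun z => abs_psi_le ht z.1 z.2)

theorem integrable_psi_fst {t : ℝ} (ht : |t| < 1) (y : ℝ) : Integrable fun x => psi t x y :=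
  integrable_of_abs_le_gaussian
    ((continuous_psi t).comp (by fun_prop : Continuous fun x : ℝ => (x, y)))
    fun x => (abs_psi_le ht x y).trans_eq (mul_right_comm _ _ _)

theorem abs_deriv_psi_fst_le {t : ℝ} (ht : |t| < 1) (x y : ℝ) :
    |-(x - t * y) / (1 - t ^ 2) * psi t x y| ≤
      8 * (1 / (1 - t ^ 2)) / (2 * Real.pi * Real.sqrt (1 - |t| ^ 2)) *
        Real.exp (-(1 / 8) * x ^ 2) * Real.exp (-(1 / 8) * y ^ 2) := by
  have h0 := one_sub_sq_pos ht
  refine abs_mul_psi_le le_rfl ht ?_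
  rw [abs_div, abs_neg, abs_of_pos h0, div_mul_eq_mul_div, one_mul]
  gcongr
  refine (abs_sub _ _).trans ?_
  rw [abs_mul]
  nlinarith [abs_nonneg y, sq_abs x, sq_abs y, sq_nonneg (|x| - 1), sq_nonneg (|y| - 1)]

theorem integrable_deriv_psi_fst {t : ℝ} (ht : |t| < 1) (y : ℝ) :
    Integrable fun x => -(x - t * y) / (1 - t ^ 2) * psi t x y := by
  have hc : Continuous fun x => psi t x y :=
    (continuous_psi t).comp (by fun_prop : Continuous fun x : ℝ => (x, y))
  exact integrable_of_abs_le_gaussian (by fun_prop)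
    fun x => (abs_deriv_psi_fst_le ht x y).trans_eq (mul_right_comm _ _ _)

theorem integrable_deriv_psi_fst_snd {t : ℝ} (ht : |t| < 1) (x : ℝ) :
    Integrable fun y => -(x - t * y) / (1 - t ^ 2) * psi t x y := by
  have hc : Continuous fun y => psi t x y :=
    (continuous_psi t).comp (by fun_prop : Continuous fun y : ℝ => (x, y))
  exact integrable_of_abs_le_gaussian (by fun_prop) fun y => abs_deriv_psi_fst_le ht x y

theorem integrable_psiMixed {t : ℝ} (ht : |t| < 1) :
    Integrable fun z : ℝ × ℝ => psiMixed t z.1 z.2 :=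
  (integrable_const_mul_exp_mul_exp _).mono' (continuous_psiMixed t).aestronglyMeasurable
    (ae_of_all _ fun z => abs_psiMixed_le le_rfl ht z.1 z.2)

theorem integrable_psiMixed_snd {t : ℝ} (ht : |t| < 1) (x : ℝ) :
    Integrable fun y => psiMixed t x y :=
  integrable_of_abs_le_gaussian
    ((continuous_psiMixed t).comp (by fun_prop : Continuous fun y : ℝ => (x, y)))
    fun y => abs_psiMixed_le le_rfl ht x y

theorem integral_Ici_of_hasDerivAt_of_integrable {f f' : ℝ → ℝ} (a : ℝ)
    (hd : ∀ x, HasDerivAt f (f' x) x) (hf : Integrable f) (hf' : Integrable f') :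
    ∫ x in Set.Ici a, f' x = -f a := by
  rw [integral_Ici_eq_integral_Ioi, integral_Ioi_of_hasDerivAt_of_tendsto' (fun x _ => hd x)
    hf'.integrableOn (tendsto_zero_of_hasDerivAt_of_integrableOn_Ioi (a := a) (fun x _ => hd x)
      hf'.integrableOn hf.integrableOn), zero_sub]

theorem setIntegral_psiMixed {t : ℝ} (ht : |t| < 1) (a b : ℝ) :
    ∫ z : ℝ × ℝ in Set.Ici a ×ˢ Set.Ici b, psiMixed t z.1 z.2 = psi t a b := by
  rw [Measure.volume_eq_prod, setIntegral_prod _ (integrable_psiMixed ht).integrableOn]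
  simp_rw [fun x => integral_Ici_of_hasDerivAt_of_integrable b (hasDerivAt_deriv_psi ht x)
    (integrable_deriv_psi_fst_snd ht x) (integrable_psiMixed_snd ht x)]
  rw [integral_neg, integral_Ici_of_hasDerivAt_of_integrable a
    (fun x => hasDerivAt_psi_fst ht x b) (integrable_psi_fst ht b) (integrable_deriv_psi_fst ht b),
    neg_neg]

/-- Plackett's identity: the correlation derivative of the quadrant probability is the density at
the corner of the quadrant. -/
theorem hasDerivAt_quadProb {t : ℝ} (ht : |t| < 1) (a b : ℝ) :
    HasDerivAt (fun t => quadProb t a b) (psi t a b) t := by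
  obtain ⟨r, htr, hr⟩ := exists_between ht
  rw [← setIntegral_psiMixed ht]
  refine (hasDerivAt_integral_of_dominated_loc_of_deriv_le (s := {u | |u| < r})
    ((isOpen_lt continuous_abs continuous_const).mem_nhds htr)
    (.of_forall fun u => (continuous_psi u).aestronglyMeasurable)
    (integrable_psi ht).integrableOn (continuous_psiMixed t).aestronglyMeasurable
    (ae_of_all _ fun z u hu => abs_psiMixed_le (le_of_lt hu) hr z.1 z.2)
    (integrable_const_mul_exp_mul_exp _).integrableOn
    (ae_of_all _ fun z u hu => hasDerivAt_psi_corr (lt_trans hu hr) z.1 z.2)).2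

theorem psi_le_of_abs_le {t r a b : ℝ} (htr : |t| ≤ r) (hr : r < 1) (ha : 0 ≤ a) (hb : 0 ≤ b) :
    psi t a b ≤ 1 / (2 * Real.pi) * (1 / Real.sqrt (1 - r ^ 2)) *
      Real.exp (-(a ^ 2 + b ^ 2) / 2) * Real.exp (r * a * b / (1 - r ^ 2)) := by
  have ht : 0 < 1 - t ^ 2 := one_sub_sq_pos (htr.trans_lt hr)
  have hr0 : 0 ≤ r := (abs_nonneg t).trans htr
  have hr' : 0 < 1 - r ^ 2 := by nlinarith
  have hsq : t ^ 2 ≤ r ^ 2 := by rw [← sq_abs t]; gcongr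
  have hs := Real.sqrt_pos.2 hr'
  rw [mul_assoc _ (Real.exp _), ← Real.exp_add, one_div_mul_one_div]
  unfold psi
  gcongr ?_ * Real.exp ?_
  · gcongr
  · have hsplit : -(a ^ 2 - 2 * t * a * b + b ^ 2) / (2 * (1 - t ^ 2)) =
        -((a ^ 2 + b ^ 2) / (2 * (1 - t ^ 2))) + t * a * b / (1 - t ^ 2) := by
      field_simp
      ring
    have h1 : (a ^ 2 + b ^ 2) / 2 ≤ (a ^ 2 + b ^ 2) / (2 * (1 - t ^ 2)) := by
      gcongr
      nlinarith [sq_nonneg t]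
    have h2 : t * a * b / (1 - t ^ 2) ≤ r * a * b / (1 - r ^ 2) := by
      gcongr
      exact (le_abs_self t).trans htr
    rw [hsplit, neg_div]
    linarith

/-- Lemma 3: for `a, b > 0` and `|δ| < 1`, with
`φ(δ,a,b) = P(Z_δ ∈ R_{a,b}) - P(Z_0 ∈ R_{a,b})`, one has
`|φ(δ,a,b)| ≤ (1/(2π)) (1/√(1-δ²)) exp(-(a²+b²)/2) exp(|δ| a b/(1-δ²)) |δ|`. -/
theorem abs_quadProb_sub_le (δ a b : ℝ) (hδ : |δ| < 1) (ha : 0 < a) (hb : 0 < b) :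
    |quadProb δ a b - quadProb 0 a b| ≤
      1 / (2 * Real.pi) * (1 / Real.sqrt (1 - δ ^ 2))
        * Real.exp (-(a ^ 2 + b ^ 2) / 2)
        * Real.exp (|δ| * a * b / (1 - δ ^ 2)) * |δ| := by
  have hmem : ∀ u : ℝ, u ∈ Set.Icc (-|δ|) |δ| ↔ |u| ≤ |δ| := fun u => abs_le.symm
  have h := (convex_Icc (-|δ|) |δ|).norm_image_sub_le_of_norm_hasDerivWithin_le
    (f := fun t => quadProb t a b) (x := 0) (y := δ)
    (fun t ht => (hasDerivAt_quadProb (((hmem t).1 ht).trans_lt hδ) a b).hasDerivWithinAt)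
    (fun t ht => (abs_of_pos (psi_pos (((hmem t).1 ht).trans_lt hδ) a b)).trans_le
      (psi_le_of_abs_le ((hmem t).1 ht) hδ ha.le hb.le))
    ((hmem 0).2 (by simp)) ((hmem δ).2 le_rfl)
  simpa only [Real.norm_eq_abs, sub_zero, sq_abs] using h
end
end

section
/- The bivariate Gaussian density ψ(δ,x,y) = (1/(2π√(1−δ²))) exp( −(x² − 2δxy + y²)/(2(1−δ²)) ), defined for |δ| < 1 and x,y ∈ ℝ, satisfies the partial differential identity ∂ψ/∂δ (δ,x,y) = ∂²ψ/∂x∂y (δ,x,y) for all |δ| < 1 and all x, y ∈ ℝ. -/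
open MeasureTheory

noncomputable section

theorem hasDerivAt_psi_right (t x y : ℝ) :
    HasDerivAt (fun v : ℝ => psi t x v) (psi t x y * ((t * x - y) / (1 - t ^ 2))) y := by
  have hquad : HasDerivAt
      (fun v : ℝ => -(x ^ 2 - 2 * t * x * v + v ^ 2) / (2 * (1 - t ^ 2)))
      (-(-(2 * t * x * 1) + 2 * y) / (2 * (1 - t ^ 2))) y := by
    simpa using ((((hasDerivAt_id y).const_mul (2 * t * x)).const_sub (x ^ 2)).add
      ((hasDerivAt_id y).pow 2)).neg.div_const (2 * (1 - t ^ 2))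
  refine (hquad.exp.const_mul (1 / (2 * Real.pi * Real.sqrt (1 - t ^ 2)))).congr_deriv ?_
  have hexponent : -(-(2 * t * x * 1) + 2 * y) / (2 * (1 - t ^ 2)) =
      (t * x - y) / (1 - t ^ 2) := by
    rw [← mul_div_mul_left (t * x - y) (1 - t ^ 2) two_ne_zero]
    ring
  rw [hexponent, psi]
  exact (mul_assoc _ _ _).symm

theorem hasDerivAt_psi_left (t x y : ℝ) :
    HasDerivAt (fun u : ℝ => psi t u y) (psi t x y * ((t * y - x) / (1 - t ^ 2))) x := by
  simpa only [psi_comm t _ y] using hasDerivAt_psi_right t y x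

theorem hasDerivAt_psi_correlation {t : ℝ} (ht : |t| < 1) (x y : ℝ) :
    HasDerivAt (fun s : ℝ => psi s x y)
      (psi t x y * (t / (1 - t ^ 2) + (t * x - y) * (t * y - x) / (1 - t ^ 2) ^ 2)) t := by
  have hpos : 0 < 1 - t ^ 2 := sub_pos.mpr ((sq_lt_one_iff_abs_lt_one t).mpr ht)
  have hsqrt : Real.sqrt (1 - t ^ 2) ≠ 0 := (Real.sqrt_pos.mpr hpos).ne'
  have hvar : HasDerivAt (fun s : ℝ => 1 - s ^ 2) (-(2 * t)) t := by
    simpa using ((hasDerivAt_id t).pow 2).const_sub 1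
  have hquad : HasDerivAt (fun s : ℝ => -(x ^ 2 - 2 * s * x * y + y ^ 2)) (2 * x * y) t := by
    refine ((((((hasDerivAt_id t).const_mul 2).mul_const x).mul_const y).const_sub
      (x ^ 2)).add_const (y ^ 2)).neg.congr_deriv ?_
    ring
  have hpref : HasDerivAt (fun s : ℝ => 1 / (2 * Real.pi * Real.sqrt (1 - s ^ 2)))
      (1 / (2 * Real.pi * Real.sqrt (1 - t ^ 2)) * (t / (1 - t ^ 2))) t := by
    have hinv := ((hvar.sqrt hpos.ne').const_mul (2 * Real.pi)).fun_inv
      (mul_ne_zero Real.two_pi_pos.ne' hsqrt)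
    simp only [one_div]
    refine hinv.congr_deriv ?_
    have hsq := Real.sq_sqrt hpos.le
    generalize Real.sqrt (1 - t ^ 2) = r at hsq hsqrt ⊢
    rw [← hsq]
    field_simp
  refine (hpref.mul (hquad.div (hvar.const_mul 2)
    (mul_ne_zero two_ne_zero hpos.ne')).exp).congr_deriv ?_
  simp only [psi, Pi.div_apply]
  have hne := hpos.ne'
  generalize 1 / (2 * Real.pi * Real.sqrt (1 - t ^ 2)) = c
  generalize Real.exp (-(x ^ 2 - 2 * t * x * y + y ^ 2) / (2 * (1 - t ^ 2))) = e
  field_simp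
  ring

/-- The identity `∂ψ/∂δ (δ,x,y) = ∂²ψ/∂x∂y (δ,x,y)` for all `|δ| < 1` and `x, y ∈ ℝ`. -/
theorem psi_partial_identity (δ x y : ℝ) (hδ : |δ| < 1) :
    deriv (fun t : ℝ => psi t x y) δ =
      deriv (fun u : ℝ => deriv (fun v : ℝ => psi δ u v) y) x := by
  have hinner : (fun u : ℝ => deriv (fun v : ℝ => psi δ u v) y) =
      fun u => psi δ u y * ((δ * u - y) / (1 - δ ^ 2)) :=
    funext fun u => (hasDerivAt_psi_right δ u y).deriv
  have hlin : HasDerivAt (fun u : ℝ => (δ * u - y) / (1 - δ ^ 2)) (δ / (1 - δ ^ 2)) x := by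
    simpa using (((hasDerivAt_id x).const_mul δ).sub_const y).div_const (1 - δ ^ 2)
  rw [hinner, (hasDerivAt_psi_correlation hδ x y).deriv,
    ((hasDerivAt_psi_left δ x y).fun_mul hlin).deriv]
  generalize 1 - δ ^ 2 = d
  ring
end
end

section
/- Let {X(s)}_{s≥0} be a centered Gaussian process with covariance kernel R satisfying assumptions (i) (with exponent ρ > 0) and (ii) (with exponent η > 0). For sufficiently large α > 1, set t_k = α^k, a_k = (2 log log t_{k+1})^{1/2}, γ_k = Var(X(t_{k+1}) − X(t_k)), and A_k = { X(t_{k+1}) − X(t_k) > γ_k^{1/2} a_k }. Then Σ_{k=1}^n Σ_{l=1}^n ( P(A_k ∩ A_l) − P(A_k) P(A_l) ) = O(√(log n)) as n → ∞. -/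
open MeasureTheory ProbabilityTheory Filter Asymptotics

noncomputable section

/-- A centered Gaussian process on `[0,∞)`. -/
def IsCenteredGaussianProcess {Ω : Type*} [MeasurableSpace Ω] (P : Measure Ω)
    (X : ℝ → Ω → ℝ) : Prop :=
  (∀ s : ℝ, Measurable (X s)) ∧
    ∀ (k : ℕ) (t : Fin k → ℝ) (c : Fin k → ℝ), (∀ i, 0 ≤ t i) →
      ∃ v : NNReal,
        Measure.map (fun ω => ∑ i, c i * X (t i) ω) P = gaussianReal 0 v

lemma gaussianPDFReal_zero_one (x : ℝ) :
    gaussianPDFReal 0 1 x = (√(2 * Real.pi))⁻¹ * Real.exp (-x ^ 2 / 2) := by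
  simp [gaussianPDFReal]

lemma gaussianPDFReal_zero_one_mul_self_le (x z E : ℝ) (h : E ≤ x ^ 2 + z ^ 2) :
    gaussianPDFReal 0 1 x * gaussianPDFReal 0 1 z ≤ Real.exp (-E / 2) / (2 * Real.pi) := by
  rw [gaussianPDFReal_zero_one, gaussianPDFReal_zero_one, mul_mul_mul_comm, ← Real.exp_add,
    ← mul_inv, Real.mul_self_sqrt (by positivity), div_eq_inv_mul (Real.exp _)]
  gcongr
  linarith

lemma abs_gaussianReal_Ioi_sub_le {y b M : ℝ}
    (hM : ∀ z ∈ Set.uIcc y b, gaussianPDFReal 0 1 z ≤ M) :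
    |(gaussianReal 0 1).real (Set.Ioi y) - (gaussianReal 0 1).real (Set.Ioi b)| ≤ |y - b| * M := by
  wlog hyb : y ≤ b generalizing y b
  · rw [abs_sub_comm, abs_sub_comm y b]
    exact this (by rwa [Set.uIcc_comm]) (le_of_not_ge hyb)
  rw [Set.uIcc_of_le hyb] at hM
  have h1 : (gaussianReal 0 1).real (Set.Ioi y) - (gaussianReal 0 1).real (Set.Ioi b)
      = (gaussianReal 0 1).real (Set.Ioc y b) := by
    rw [← Set.Ioc_union_Ioi_eq_Ioi hyb, measureReal_union (by
      rw [Set.disjoint_left]; intro x hx hx'; exact absurd hx.2 (not_le.2 hx')) measurableSet_Ioi]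
    ring
  rw [h1, abs_of_nonneg measureReal_nonneg, measureReal_def,
    gaussianReal_apply_eq_integral 0 one_ne_zero, ENNReal.toReal_ofReal
      (integral_nonneg fun x => gaussianPDFReal_nonneg 0 1 x)]
  calc ∫ x in Set.Ioc y b, gaussianPDFReal 0 1 x ≤ ∫ x in Set.Ioc y b, M := by
        refine setIntegral_mono_on (integrable_gaussianPDFReal 0 1).integrableOn (by simp)
          measurableSet_Ioc fun x hx => hM x ⟨hx.1.le, hx.2⟩
    _ = |y - b| * M := by
        rw [abs_of_nonpos (by linarith)]; simp [hyb]

lemma hasDerivAt_neg_exp_neg_sq {c : ℝ} (hc : c ≠ 0) (x : ℝ) :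
    HasDerivAt (fun x : ℝ => -(c * Real.exp (-x ^ 2 / (2 * c)))) (x * Real.exp (-x ^ 2 / (2 * c))) x := by
  have h : HasDerivAt (fun x : ℝ => -x ^ 2 / (2 * c)) (-(2 * x) / (2 * c)) x := by
    simpa using ((hasDerivAt_pow 2 x).neg).div_const (2 * c)
  refine (h.exp.const_mul c).neg.congr_deriv ?_
  field_simp

lemma tendsto_neg_exp_neg_sq {c : ℝ} (hc : 0 < c) :
    Tendsto (fun x : ℝ => -(c * Real.exp (-x ^ 2 / (2 * c)))) atTop (nhds 0) := by
  have h : Tendsto (fun x : ℝ => -x ^ 2 / (2 * c)) atTop atBot := by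
    have := (tendsto_pow_atTop (α := ℝ) two_ne_zero).atTop_div_const (r := 2 * c) (by positivity)
    refine (tendsto_neg_atTop_atBot.comp this).congr fun _ => ?_
    simp [neg_div]
  simpa using ((Real.tendsto_exp_atBot.comp h).const_mul c).neg

lemma integrableOn_mul_exp_neg_sq {a c : ℝ} (ha : 0 ≤ a) (hc : 0 < c) :
    IntegrableOn (fun x : ℝ => x * Real.exp (-x ^ 2 / (2 * c))) (Set.Ioi a) :=
  integrableOn_Ioi_deriv_of_nonneg' (fun x _ => hasDerivAt_neg_exp_neg_sq hc.ne' x)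
    (fun _ hx => mul_nonneg (ha.trans (le_of_lt hx)) (Real.exp_nonneg _)) (tendsto_neg_exp_neg_sq hc)

lemma integral_Ioi_mul_exp_neg_sq {a c : ℝ} (ha : 0 ≤ a) (hc : 0 < c) :
    ∫ x in Set.Ioi a, x * Real.exp (-x ^ 2 / (2 * c)) = c * Real.exp (-a ^ 2 / (2 * c)) := by
  rw [integral_Ioi_of_hasDerivAt_of_nonneg' (fun x _ => hasDerivAt_neg_exp_neg_sq hc.ne' x)
    (fun _ hx => mul_nonneg (ha.trans (le_of_lt hx)) (Real.exp_nonneg _))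
    (tendsto_neg_exp_neg_sq hc)]
  ring

lemma gaussianReal_Ioi_le {a : ℝ} (ha : 0 < a) :
    (gaussianReal 0 1).real (Set.Ioi a) ≤ Real.exp (-a ^ 2 / 2) / a := by
  rw [measureReal_def, gaussianReal_apply_eq_integral 0 one_ne_zero, ENNReal.toReal_ofReal
      (integral_nonneg fun x => gaussianPDFReal_nonneg 0 1 x)]
  have hi := integrableOn_mul_exp_neg_sq ha.le one_pos
  have hv := integral_Ioi_mul_exp_neg_sq ha.le one_pos
  calc ∫ x in Set.Ioi a, gaussianPDFReal 0 1 x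
      ≤ ∫ x in Set.Ioi a, a⁻¹ * (x * Real.exp (-x ^ 2 / (2 * 1))) := by
        refine setIntegral_mono_on (integrable_gaussianPDFReal 0 1).integrableOn
          (hi.const_mul _) measurableSet_Ioi fun x hx => ?_
        have hx : a < x := hx
        rw [gaussianPDFReal_zero_one, ← mul_assoc, mul_one]
        gcongr
        calc (√(2 * Real.pi))⁻¹ ≤ 1 := by
              apply inv_le_one_of_one_le₀
              rw [Real.one_le_sqrt]
              linarith [Real.pi_gt_three]
          _ ≤ a⁻¹ * x := by rw [inv_mul_eq_div, one_le_div ha]; exact hx.le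
    _ = Real.exp (-a ^ 2 / 2) / a := by
        rw [integral_const_mul, hv]; simp; ring

/-- On the segment from the conditional threshold to `b`, the joint Gaussian exponent is controlled. -/
lemma sq_add_sq_div_le {r x b z : ℝ} (hr : |r| < 1) (hx : 0 ≤ x) (hb : 0 ≤ b)
    (hz : z ∈ Set.uIcc ((b - r * x) / √(1 - r ^ 2)) b) :
    (x ^ 2 + b ^ 2) / (1 + |r|) ≤ x ^ 2 + z ^ 2 := by
  have hr2 : r ^ 2 < 1 := by rw [← sq_abs]; nlinarith [abs_nonneg r]
  have hs : 0 < √(1 - r ^ 2) := Real.sqrt_pos.2 (by linarith)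
  have hs2 : √(1 - r ^ 2) ^ 2 = 1 - r ^ 2 := Real.sq_sqrt (by linarith)
  set y := (b - r * x) / √(1 - r ^ 2) with hy
  have h0 := abs_nonneg r
  have hb' : (x ^ 2 + b ^ 2) / (1 + |r|) ≤ x ^ 2 + b ^ 2 :=
    div_le_self (by positivity) (by linarith)
  have hle : r * x * b ≤ |r| * x * b := by
    gcongr; exact le_abs_self r
  have hy' : (x ^ 2 + b ^ 2) / (1 + |r|) ≤ x ^ 2 + y ^ 2 := by
    have h1 : x ^ 2 + y ^ 2 = (x ^ 2 + b ^ 2 - 2 * (r * x * b)) / (1 - r ^ 2) := by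
      rw [hy, div_pow, hs2]
      field_simp [(by linarith : (1 - r ^ 2) ≠ 0)]
      ring
    rw [h1, div_le_div_iff₀ (by linarith) (by linarith)]
    have h3 : 1 - r ^ 2 = (1 - |r|) * (1 + |r|) := by rw [← sq_abs]; ring
    rw [h3, ← mul_assoc]
    gcongr
    nlinarith [mul_nonneg h0 (sq_nonneg (x - b))]
  by_cases hy0 : 0 ≤ y
  · have : y ^ 2 ≤ z ^ 2 ∨ b ^ 2 ≤ z ^ 2 := by
      rcases Set.mem_uIcc.1 hz with h | h
      · left; exact pow_le_pow_left₀ hy0 h.1 2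
      · right; exact pow_le_pow_left₀ hb h.1 2
    rcases this with h | h <;> linarith
  · have hlt : b < r * x := by
      by_contra h
      exact hy0 (div_nonneg (by linarith) hs.le)
    have hlt' : b ≤ |r| * x := hlt.le.trans (by gcongr; exact le_abs_self r)
    have hbx : b ^ 2 ≤ |r| * x ^ 2 := by
      calc b ^ 2 ≤ (|r| * x) ^ 2 := by gcongr
        _ = |r| * (|r| * x ^ 2) := by ring
        _ ≤ 1 * (|r| * x ^ 2) := by gcongr
        _ = _ := by ring
    rw [div_le_iff₀ (by linarith)]
    nlinarith [sq_nonneg z]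

/-- Conditional version of the normal comparison inequality. -/
lemma gaussianPDFReal_mul_abs_sub_le {r x b : ℝ} (hr : |r| ≤ 1 / 2) (hb : 0 ≤ b) (hbx : b ≤ x) :
    gaussianPDFReal 0 1 x * |(gaussianReal 0 1).real (Set.Ioi ((b - r * x) / √(1 - r ^ 2)))
      - (gaussianReal 0 1).real (Set.Ioi b)|
      ≤ |r| * Real.exp (-b ^ 2 / (2 * (1 + |r|))) * (x * Real.exp (-x ^ 2 / (2 * (1 + |r|)))) := by
  have hx : 0 ≤ x := hb.trans hbx
  set y := (b - r * x) / √(1 - r ^ 2) with hy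
  have h0 := abs_nonneg r
  have hφ : 0 < gaussianPDFReal 0 1 x := gaussianPDFReal_pos 0 1 x one_ne_zero
  have hr4 : r ^ 2 ≤ |r| / 2 := by rw [← sq_abs]; nlinarith
  have hs1 : √(1 - r ^ 2) ≤ 1 := by
    rw [Real.sqrt_le_one]; nlinarith
  have hs2 : √(1 - r ^ 2) ^ 2 = 1 - r ^ 2 := Real.sq_sqrt (by linarith)
  have hs0 : 1 - |r| / 2 ≤ √(1 - r ^ 2) := by
    apply Real.le_sqrt_of_sq_le; rw [← sq_abs r]; nlinarith
  have hspos : 3 / 4 ≤ √(1 - r ^ 2) := by linarith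
  have hd : |y - b| ≤ 2 * |r| * x := by
    have : y - b = (b * (1 - √(1 - r ^ 2)) - r * x) / √(1 - r ^ 2) := by
      rw [hy]; field_simp; ring
    rw [this, abs_div, abs_of_pos (by linarith : 0 < √(1 - r ^ 2)), div_le_iff₀ (by linarith)]
    calc |b * (1 - √(1 - r ^ 2)) - r * x| ≤ |b * (1 - √(1 - r ^ 2))| + |r * x| := abs_sub _ _
      _ = b * (1 - √(1 - r ^ 2)) + |r| * x := by
        rw [abs_of_nonneg (mul_nonneg hb (by linarith)), abs_mul, abs_of_nonneg hx]
      _ ≤ x * (|r| / 2) + |r| * x := by gcongr; linarith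
      _ ≤ 2 * |r| * x * (3 / 4) := by nlinarith
      _ ≤ _ := by gcongr
  have hE := abs_gaussianReal_Ioi_sub_le (y := y) (b := b)
    (M := Real.exp (-((x ^ 2 + b ^ 2) / (1 + |r|)) / 2) / (2 * Real.pi) / gaussianPDFReal 0 1 x)
    (fun z hz => by
      rw [le_div_iff₀ hφ, mul_comm]
      exact gaussianPDFReal_zero_one_mul_self_le _ _ _
        (sq_add_sq_div_le (by linarith) hx hb hz))
  calc _ ≤ gaussianPDFReal 0 1 x * (|y - b| *
        (Real.exp (-((x ^ 2 + b ^ 2) / (1 + |r|)) / 2) / (2 * Real.pi) / gaussianPDFReal 0 1 x)) := by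
        gcongr
    _ = |y - b| * (Real.exp (-((x ^ 2 + b ^ 2) / (1 + |r|)) / 2) / (2 * Real.pi)) := by
        field_simp
    _ ≤ (2 * |r| * x) * (Real.exp (-((x ^ 2 + b ^ 2) / (1 + |r|)) / 2) / 2) := by
        gcongr; linarith [Real.pi_gt_three]
    _ = _ := by
        have : -((x ^ 2 + b ^ 2) / (1 + |r|)) / 2
          = -b ^ 2 / (2 * (1 + |r|)) + -x ^ 2 / (2 * (1 + |r|)) := by
          field_simp; ring
        rw [this, Real.exp_add]; ring

lemma integrable_gaussianReal_Ioi_comp {f : ℝ → ℝ} (hf : Measurable f) :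
    Integrable (fun x => (gaussianReal 0 1).real (Set.Ioi (f x))) (gaussianReal 0 1) := by
  have hm : Measurable fun x => (gaussianReal 0 1).real (Set.Ioi (f x)) := by
    have : Antitone fun y : ℝ => (gaussianReal 0 1).real (Set.Ioi y) :=
      fun x y h => measureReal_mono (Set.Ioi_subset_Ioi h)
    exact this.measurable.comp hf
  refine Integrable.of_bound hm.aestronglyMeasurable 1 (ae_of_all _ fun x => ?_)
  rw [Real.norm_of_nonneg measureReal_nonneg]
  exact measureReal_le_one

/-- Normal comparison inequality for two correlated standard Gaussians built from independent
ones. -/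
lemma abs_prod_gaussianReal_sub_le {r a b : ℝ} (hr : |r| ≤ 1 / 2) (hb : 0 ≤ b) (hba : b ≤ a) :
    |((gaussianReal 0 1).prod (gaussianReal 0 1)).real
        {p : ℝ × ℝ | a < p.1 ∧ b < r * p.1 + √(1 - r ^ 2) * p.2}
      - (gaussianReal 0 1).real (Set.Ioi a) * (gaussianReal 0 1).real (Set.Ioi b)|
      ≤ 2 * |r| * Real.exp (-(a ^ 2 + b ^ 2) / (2 * (1 + |r|))) := by
  have ha : 0 ≤ a := hb.trans hba
  have h0 := abs_nonneg r
  have hs : 0 < √(1 - r ^ 2) := Real.sqrt_pos.2 (by rw [← sq_abs]; nlinarith)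
  set f : ℝ → ℝ := fun x => (b - r * x) / √(1 - r ^ 2) with hf
  have hfm : Measurable f := by fun_prop
  have hint := integrable_gaussianReal_Ioi_comp hfm
  have hS : MeasurableSet {p : ℝ × ℝ | a < p.1 ∧ b < r * p.1 + √(1 - r ^ 2) * p.2} :=
    measurableSet_lt measurable_const measurable_fst |>.inter <|
      measurableSet_lt measurable_const ((measurable_fst.const_mul r).add (measurable_snd.const_mul _))
  have hprod : ((gaussianReal 0 1).prod (gaussianReal 0 1)).real
        {p : ℝ × ℝ | a < p.1 ∧ b < r * p.1 + √(1 - r ^ 2) * p.2}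
      = ∫ x in Set.Ioi a, (gaussianReal 0 1).real (Set.Ioi (f x)) ∂(gaussianReal 0 1) := by
    rw [← integral_indicator measurableSet_Ioi, measureReal_def, Measure.prod_apply hS,
      ← integral_toReal (measurable_measure_prodMk_left hS).aemeasurable
        (ae_of_all _ fun x => measure_lt_top _ _)]
    refine integral_congr_ae (ae_of_all _ fun x => ?_)
    by_cases hx : a < x
    · simp only [Set.indicator_of_mem (show x ∈ Set.Ioi a from hx), measureReal_def]
      congr 2
      ext w
      simp only [Set.mem_preimage, Set.mem_ofPred_eq, hx, true_and, Set.mem_Ioi, hf]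
      rw [div_lt_iff₀ hs]
      constructor <;> intro h <;> linarith
    · simp [hx]
  have hconst : (gaussianReal 0 1).real (Set.Ioi a) * (gaussianReal 0 1).real (Set.Ioi b)
      = ∫ x in Set.Ioi a, (gaussianReal 0 1).real (Set.Ioi b) ∂(gaussianReal 0 1) := by
    simp
  rw [hprod, hconst, ← integral_sub hint.integrableOn (by simp), ← integral_indicator
    measurableSet_Ioi, integral_gaussianReal_eq_integral_smul one_ne_zero]
  have hi := (integrableOn_mul_exp_neg_sq ha (by linarith : 0 < 1 + |r|)).const_mul
    (|r| * Real.exp (-b ^ 2 / (2 * (1 + |r|))))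
  have hmain := norm_integral_le_of_norm_le (f := fun x => gaussianPDFReal 0 1 x •
      (Set.Ioi a).indicator (fun x => (gaussianReal 0 1).real (Set.Ioi (f x))
        - (gaussianReal 0 1).real (Set.Ioi b)) x) (integrable_indicator_iff measurableSet_Ioi |>.2 hi)
      (ae_of_all _ fun x => by
        by_cases hx : x ∈ Set.Ioi a
        · simp only [Set.indicator_of_mem hx, smul_eq_mul, norm_mul]
          rw [Real.norm_of_nonneg (gaussianPDFReal_nonneg 0 1 x), Real.norm_eq_abs]
          exact gaussianPDFReal_mul_abs_sub_le hr hb (hba.trans (le_of_lt hx))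
        · simp [Set.indicator_of_notMem hx])
  rw [integral_indicator measurableSet_Ioi, integral_const_mul,
    integral_Ioi_mul_exp_neg_sq ha (by linarith)] at hmain
  refine hmain.trans ?_
  have : -(a ^ 2 + b ^ 2) / (2 * (1 + |r|))
    = -b ^ 2 / (2 * (1 + |r|)) + -a ^ 2 / (2 * (1 + |r|)) := by
    field_simp; ring
  rw [this, Real.exp_add]
  calc _ = (1 + |r|) * (|r| * (Real.exp (-b ^ 2 / (2 * (1 + |r|)))
          * Real.exp (-a ^ 2 / (2 * (1 + |r|))))) := by ring
    _ ≤ 2 * (|r| * (Real.exp (-b ^ 2 / (2 * (1 + |r|)))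
          * Real.exp (-a ^ 2 / (2 * (1 + |r|))))) := by gcongr; linarith
    _ = _ := by ring

section Law

variable {Ω : Type*} [MeasurableSpace Ω] {P : Measure Ω}

lemma ProbabilityTheory.HasGaussianLaw.map_eq_standard {U : Ω → ℝ} (hU : HasGaussianLaw U P)
    (hmean : ∫ ω, U ω ∂P = 0) (hvar : variance U P = 1) : P.map U = gaussianReal 0 1 := by
  rw [hU.map_eq_gaussianReal, hmean, hvar]; simp

/-- Normal comparison inequality for a standardized jointly Gaussian pair. -/
lemma ProbabilityTheory.HasGaussianLaw.abs_measureReal_inter_sub_le [IsProbabilityMeasure P]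
    {U V : Ω → ℝ}
    (hUV : HasGaussianLaw (fun ω => (U ω, V ω)) P)
    (hU0 : ∫ ω, U ω ∂P = 0) (hV0 : ∫ ω, V ω ∂P = 0) (hU1 : variance U P = 1)
    (hV1 : variance V P = 1) (hr : |cov[U, V; P]| ≤ 1 / 2) {a b : ℝ}
    (hb : 0 ≤ b) (hba : b ≤ a) :
    |P.real {ω | a < U ω ∧ b < V ω} - P.real {ω | a < U ω} * P.real {ω | b < V ω}|
      ≤ 2 * |cov[U, V; P]| * Real.exp (-(a ^ 2 + b ^ 2) / (2 * (1 + |cov[U, V; P]|))) := by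
  set r := cov[U, V; P] with hrdef
  have h0 := abs_nonneg r
  have hs : 0 < √(1 - r ^ 2) := Real.sqrt_pos.2 (by rw [← sq_abs]; nlinarith)
  have hs2 : √(1 - r ^ 2) ^ 2 = 1 - r ^ 2 := Real.sq_sqrt (by rw [← sq_abs]; nlinarith)
  set s := √(1 - r ^ 2) with hsdef
  have hU := hUV.fst
  have hV := hUV.snd
  have hUm := hU.memLp_two
  have hVm := hV.memLp_two
  set W : Ω → ℝ := fun ω => s⁻¹ * (V ω - r * U ω) with hW
  have hUW : HasGaussianLaw (fun ω => (U ω, W ω)) P := by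
    have := hUV.map_fun ((ContinuousLinearMap.fst ℝ ℝ ℝ).prod
      (s⁻¹ • (ContinuousLinearMap.snd ℝ ℝ ℝ - r • ContinuousLinearMap.fst ℝ ℝ ℝ)))
    simpa [hW] using this
  have hW0 : ∫ ω, W ω ∂P = 0 := by
    rw [hW, integral_const_mul, integral_sub hV.integrable (hU.integrable.const_mul _),
      integral_const_mul, hU0, hV0]; simp
  have hcov : cov[U, W; P] = 0 := by
    rw [hW, covariance_const_mul_right, covariance_fun_sub_right hUm hVm (hUm.const_mul _),
      covariance_const_mul_right, covariance_self hU.aemeasurable, hU1, ← hrdef]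
    simp
  have hW1 : variance W P = 1 := by
    rw [hW, variance_const_mul, variance_fun_sub hVm (hUm.const_mul _), variance_const_mul,
      covariance_const_mul_right, covariance_comm, hU1, hV1, ← hrdef]
    rw [inv_pow, hs2]
    have : 1 - r ^ 2 ≠ 0 := by rw [← hs2]; positivity
    field_simp
    ring
  have hind := hUW.indepFun_of_covariance_eq_zero hcov
  have hmap := hind.map_prod_eq_prod_map_map hU.aemeasurable hUW.snd.aemeasurable
  rw [hU.map_eq_standard hU0 hU1, hUW.snd.map_eq_standard hW0 hW1] at hmap
  have hVW : ∀ ω, V ω = r * U ω + s * W ω := fun ω => by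
    simp only [hW]; field_simp; ring
  have e1 : P.real {ω | a < U ω} = (gaussianReal 0 1).real (Set.Ioi a) := by
    rw [← hU.map_eq_standard hU0 hU1,
      map_measureReal_apply_of_aemeasurable hU.aemeasurable measurableSet_Ioi]; rfl
  have e2 : P.real {ω | b < V ω} = (gaussianReal 0 1).real (Set.Ioi b) := by
    rw [← hV.map_eq_standard hV0 hV1,
      map_measureReal_apply_of_aemeasurable hV.aemeasurable measurableSet_Ioi]; rfl
  have hS : MeasurableSet {p : ℝ × ℝ | a < p.1 ∧ b < r * p.1 + s * p.2} :=
    measurableSet_lt measurable_const measurable_fst |>.inter <|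
      measurableSet_lt measurable_const ((measurable_fst.const_mul r).add (measurable_snd.const_mul _))
  have e3 : P.real {ω | a < U ω ∧ b < V ω} = ((gaussianReal 0 1).prod (gaussianReal 0 1)).real
        {p : ℝ × ℝ | a < p.1 ∧ b < r * p.1 + s * p.2} := by
    rw [← hmap, map_measureReal_apply_of_aemeasurable hUW.aemeasurable hS]
    congr 1
    ext ω
    simp [hVW ω]
  rw [e1, e2, e3]
  exact abs_prod_gaussianReal_sub_le hr hb hba

end Law

lemma sum_inv_mul_sqrt_log_le (n : ℕ) :
    ∑ k ∈ Finset.Icc 1 n, 1 / (((k : ℝ) + 1) * √(Real.log (k + 1))) ≤ 2 * √(Real.log (n + 1)) := by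
  induction n with
  | zero => simp
  | succ n ih =>
    rw [Finset.sum_Icc_succ_top (by omega)]
    push_cast
    have hn : (0 : ℝ) ≤ n := n.cast_nonneg
    set x := √(Real.log ((n : ℝ) + 1)) with hx
    set y := √(Real.log ((n : ℝ) + 1 + 1)) with hy
    have hx2 : x ^ 2 = Real.log ((n : ℝ) + 1) := Real.sq_sqrt (Real.log_nonneg (by linarith))
    have hy2 : y ^ 2 = Real.log ((n : ℝ) + 1 + 1) := Real.sq_sqrt (Real.log_nonneg (by linarith))
    have hypos : 0 < y := Real.sqrt_pos.2 (Real.log_pos (by linarith))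
    have hx0 : 0 ≤ x := Real.sqrt_nonneg _
    have hxy : x ≤ y := Real.sqrt_le_sqrt (Real.log_le_log (by linarith) (by linarith))
    have hlog : 1 / ((n : ℝ) + 1 + 1) ≤ y ^ 2 - x ^ 2 := by
      rw [hx2, hy2, ← Real.log_div (by positivity) (by positivity)]
      have := Real.one_sub_inv_le_log_of_pos (x := ((n : ℝ) + 1 + 1) / (n + 1)) (by positivity)
      refine le_trans (le_of_eq ?_) this
      field_simp
      ring
    have : 1 / (((n : ℝ) + 1 + 1) * y) ≤ 2 * y - 2 * x := by
      rw [← div_div, div_le_iff₀ hypos]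
      nlinarith
    linarith

/-- Interpolating `k + m ≥ k ^ θ * m ^ (1 - θ)` separates the variables in the double sum. -/
lemma rpow_mul_rpow_add_le {k m p θ : ℝ} (hk : 1 ≤ k) (hm : 1 ≤ m) (hp : 0 ≤ p) (hθ0 : 0 ≤ θ)
    (hθ1 : θ ≤ 1) :
    k ^ (-p) * (k + m) ^ (-p) ≤ k ^ (-(p * (1 + θ))) * m ^ (-(p * (1 - θ))) := by
  have hk0 : 0 < k := by linarith
  have hm0 : 0 < m := by linarith
  have h1 : (k + m) ^ (-p) = (k + m) ^ (-(p * θ)) * (k + m) ^ (-(p * (1 - θ))) := by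
    rw [← Real.rpow_add (by linarith)]; ring_nf
  have h2 : k ^ (-(p * (1 + θ))) = k ^ (-p) * k ^ (-(p * θ)) := by
    rw [← Real.rpow_add hk0]; ring_nf
  rw [h1, h2, mul_assoc]
  have e1 : (k + m) ^ (-(p * θ)) ≤ k ^ (-(p * θ)) :=
    Real.rpow_le_rpow_of_nonpos hk0 (by linarith) (by nlinarith)
  have e2 : (k + m) ^ (-(p * (1 - θ))) ≤ m ^ (-(p * (1 - θ))) :=
    Real.rpow_le_rpow_of_nonpos hm0 (by linarith) (by nlinarith)
  gcongr

lemma exp_neg_le_rpow_mul_rpow {k l x y q p : ℝ} (hk : 1 ≤ k) (hl : 1 ≤ l) (hx : k ≤ x) (hy : l ≤ y)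
    (hq : 0 ≤ q) (hpq : p ≤ 1 - q) :
    Real.exp (-(2 * Real.log x + 2 * Real.log y) / (2 * (1 + q))) ≤ k ^ (-p) * l ^ (-p) := by
  rw [Real.rpow_def_of_pos (by linarith), Real.rpow_def_of_pos (by linarith), ← Real.exp_add,
    Real.exp_le_exp, div_le_iff₀ (by linarith)]
  have h1 := Real.log_le_log (by linarith) hx
  have h2 := Real.log_le_log (by linarith) hy
  have h3 := Real.log_nonneg hk
  have h4 := Real.log_nonneg hl
  have h5 : p * (1 + q) ≤ 1 := by nlinarith
  nlinarith

lemma abs_sum_sum_le_of_summable {c : ℕ → ℕ → ℝ} {u v q : ℕ → ℝ} (hsymm : ∀ k l, c k l = c l k)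
    (hu : Summable u) (hv : Summable v) (hu0 : ∀ k, 0 ≤ u k) (hv0 : ∀ k, 0 ≤ v k)
    (hq : ∀ k, 1 ≤ k → |c k k| ≤ q k)
    (hc : ∀ k m, 1 ≤ k → 1 ≤ m → |c k (k + m)| ≤ u k * v m) (n : ℕ) :
    |∑ k ∈ Finset.Icc 1 n, ∑ l ∈ Finset.Icc 1 n, c k l|
      ≤ ∑ k ∈ Finset.Icc 1 n, q k + 2 * ((∑' k, u k) * ∑' k, v k) := by
  set g : ℕ → ℕ → ℝ := fun k l => if k < l then u k * v (l - k) else 0 with hg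
  have hg0 : ∀ k l, 0 ≤ g k l := fun k l => by
    simp only [hg]; split_ifs
    · exact mul_nonneg (hu0 _) (hv0 _)
    · exact le_rfl
  have hpt : ∀ k ∈ Finset.Icc 1 n, ∀ l ∈ Finset.Icc 1 n,
      |c k l| ≤ (if k = l then q k else 0) + g k l + g l k := by
    have hlt : ∀ k l, 1 ≤ k → k < l → |c k l| ≤ g k l := fun k l hk hkl => by
      have := hc k (l - k) hk (by omega)
      rw [Nat.add_sub_cancel' hkl.le] at this
      simpa [hg, hkl] using this
    intro k hk l hl
    rw [Finset.mem_Icc] at hk hl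
    rcases lt_trichotomy k l with h | h | h
    · rw [if_neg h.ne]; linarith [hlt k l hk.1 h, hg0 l k]
    · subst h; rw [if_pos rfl]; linarith [hq k hk.1, hg0 k k]
    · rw [if_neg h.ne', hsymm]; linarith [hlt l k hl.1 h, hg0 k l]
  have hinner : ∀ k, ∑ l ∈ Finset.Icc 1 n, g k l ≤ u k * ∑' m, v m := fun k => by
    simp only [hg]
    rw [← Finset.sum_filter, ← Finset.mul_sum]
    refine mul_le_mul_of_nonneg_left ?_ (hu0 k)
    rw [← Finset.sum_image (f := v) (g := fun l => l - k)]
    · exact hv.sum_le_tsum _ fun i _ => hv0 i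
    · intro x hx y hy hxy
      simp only [Finset.coe_filter, Set.mem_ofPred_eq] at hx hy
      simp only at hxy
      omega
  have hgsum : ∑ k ∈ Finset.Icc 1 n, ∑ l ∈ Finset.Icc 1 n, g k l
      ≤ (∑' k, u k) * ∑' k, v k := by
    refine (Finset.sum_le_sum fun k _ => hinner k).trans ?_
    rw [← Finset.sum_mul]
    exact mul_le_mul_of_nonneg_right (hu.sum_le_tsum _ fun i _ => hu0 i) (tsum_nonneg hv0)
  calc |∑ k ∈ Finset.Icc 1 n, ∑ l ∈ Finset.Icc 1 n, c k l|
      ≤ ∑ k ∈ Finset.Icc 1 n, ∑ l ∈ Finset.Icc 1 n, |c k l| :=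
        (Finset.abs_sum_le_sum_abs _ _).trans
          (Finset.sum_le_sum fun k _ => Finset.abs_sum_le_sum_abs _ _)
    _ ≤ ∑ k ∈ Finset.Icc 1 n, ∑ l ∈ Finset.Icc 1 n,
          ((if k = l then q k else 0) + g k l + g l k) :=
        Finset.sum_le_sum fun k hk => Finset.sum_le_sum fun l hl => hpt k hk l hl
    _ = ∑ k ∈ Finset.Icc 1 n, q k + ∑ k ∈ Finset.Icc 1 n, ∑ l ∈ Finset.Icc 1 n, g k l
          + ∑ k ∈ Finset.Icc 1 n, ∑ l ∈ Finset.Icc 1 n, g k l := by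
        simp only [Finset.sum_add_distrib]
        rw [Finset.sum_comm (f := fun k l => g l k)]
        congr 2
        refine Finset.sum_congr rfl fun k hk => ?_
        rw [Finset.sum_ite_eq, if_pos hk]
    _ ≤ _ := by linarith

/-- Decay of the correlations of the normalized increments along a geometric sequence. -/
lemma abs_increment_correlation_le {h : ℕ → ℝ} {B ε η : ℝ} (hB : 1 ≤ B) (h0 : 0 < h 0)
    (hη0 : 0 ≤ η) (hη1 : η ≤ 1) (hε : ε ≤ h 0 / 4)
    (hh : ∀ j : ℕ, 1 ≤ j → |h j| ≤ ε * (j : ℝ) ^ (-η)) (m : ℕ) :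
    |((B ^ 2 + 1) * h (m + 1) - B * h m - B * h (m + 2)) / ((B ^ 2 + 1) * h 0 - 2 * B * h 1)|
      ≤ (10 * ε / h 0 + 2 / B) * ((m + 1 : ℕ) : ℝ) ^ (-η) := by
  have h1 : |h 1| ≤ ε := by simpa using hh 1 le_rfl
  have hε0 : 0 ≤ ε := (abs_nonneg _).trans h1
  have hBB : B ≤ B ^ 2 := by nlinarith
  have hD : B ^ 2 * h 0 / 2 ≤ (B ^ 2 + 1) * h 0 - 2 * B * h 1 := by
    have : h 1 ≤ h 0 / 4 := (le_abs_self _).trans (h1.trans hε)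
    nlinarith [mul_le_mul_of_nonneg_left this (by linarith : 0 ≤ 2 * B),
      mul_le_mul_of_nonneg_right hBB h0.le]
  have hDpos : 0 < B ^ 2 * h 0 / 2 := by positivity
  rw [abs_div, abs_of_pos (hDpos.trans_le hD)]
  set w := ((m + 1 : ℕ) : ℝ) ^ (-η) with hw
  have hw0 : 0 ≤ w := by positivity
  have hm1 : |h (m + 1)| ≤ ε * w := hh (m + 1) (by omega)
  have hm2 : |h (m + 2)| ≤ ε * w := (hh (m + 2) (by omega)).trans <|
    mul_le_mul_of_nonneg_left (Real.rpow_le_rpow_of_nonpos (by positivity)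
      (by push_cast; linarith) (by linarith)) hε0
  have hm : |B * h m| ≤ (2 * B ^ 2 * ε + B * h 0) * w := by
    rw [abs_mul, abs_of_nonneg (by linarith : 0 ≤ B)]
    rcases Nat.eq_zero_or_pos m with rfl | hmpos
    · rw [abs_of_pos h0]
      have : w = 1 := by simp [hw]
      rw [this]
      nlinarith [mul_nonneg (sq_nonneg B) hε0]
    · have hm' : (1 : ℝ) ≤ m := by exact_mod_cast hmpos
      have e1 : (m : ℝ) ^ (-η) ≤ 2 * w := by
        have e2 : (2 : ℝ) ^ (-η) * (m : ℝ) ^ (-η) ≤ w := by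
          rw [← Real.mul_rpow (by norm_num) (by positivity)]
          exact Real.rpow_le_rpow_of_nonpos (by positivity) (by push_cast; linarith) (by linarith)
        have e3 : (1 / 2 : ℝ) ≤ 2 ^ (-η) := by
          calc (1 / 2 : ℝ) = 2 ^ (-1 : ℝ) := by rw [Real.rpow_neg_one]; norm_num
            _ ≤ 2 ^ (-η) := Real.rpow_le_rpow_of_exponent_le (by norm_num) (by linarith)
        nlinarith [mul_le_mul_of_nonneg_right e3 (by positivity : 0 ≤ (m : ℝ) ^ (-η))]
      calc B * |h m| ≤ B ^ 2 * (ε * (2 * w)) := by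
            gcongr
            exact (hh m hmpos).trans (by gcongr)
        _ ≤ _ := by nlinarith [mul_nonneg (mul_nonneg (by linarith : 0 ≤ B) h0.le) hw0]
  have hnum : |(B ^ 2 + 1) * h (m + 1) - B * h m - B * h (m + 2)|
      ≤ (5 * B ^ 2 * ε + B * h 0) * w := by
    have e1 : |(B ^ 2 + 1) * h (m + 1)| ≤ 2 * B ^ 2 * (ε * w) := by
      rw [abs_mul, abs_of_nonneg (by positivity)]
      gcongr
      nlinarith
    have e2 : |B * h (m + 2)| ≤ B ^ 2 * (ε * w) := by
      rw [abs_mul, abs_of_nonneg (by linarith)]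
      gcongr
    calc _ ≤ |(B ^ 2 + 1) * h (m + 1)| + |B * h m| + |B * h (m + 2)| :=
          (abs_sub _ _).trans (by gcongr; exact abs_sub _ _)
      _ ≤ _ := by linarith
  calc _ ≤ (5 * B ^ 2 * ε + B * h 0) * w / (B ^ 2 * h 0 / 2) := by gcongr
    _ = _ := by field_simp; ring

section CenteredGaussian

variable {Ω : Type*} [MeasurableSpace Ω] {P : Measure Ω} {X : ℝ → Ω → ℝ}

lemma IsCenteredGaussianProcess.hasGaussianLaw_increments (hG : IsCenteredGaussianProcess P X)
    {s₁ s₂ s₃ s₄ : ℝ} (h₁ : 0 ≤ s₁) (h₂ : 0 ≤ s₂) (h₃ : 0 ≤ s₃) (h₄ : 0 ≤ s₄) (c d : ℝ) :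
    HasGaussianLaw (fun ω => (c * (X s₁ ω - X s₂ ω), d * (X s₃ ω - X s₄ ω))) P := by
  have hm := hG.1
  refine ⟨isGaussian_of_map_eq_gaussianReal fun L => ?_⟩
  obtain ⟨v, hv⟩ := hG.2 4 ![s₁, s₂, s₃, s₄]
    ![L (1, 0) * c, -(L (1, 0) * c), L (0, 1) * d, -(L (0, 1) * d)]
    (by intro i; fin_cases i <;> simpa)
  refine ⟨0, v, ?_⟩
  rw [Measure.map_map (by fun_prop) (by fun_prop), ← hv]
  congr 1
  ext ω
  have hL : ∀ x y : ℝ, L (x, y) = x * L (1, 0) + y * L (0, 1) := fun x y => by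
    have : (x, y) = x • ((1 : ℝ), (0 : ℝ)) + y • ((0 : ℝ), (1 : ℝ)) := by simp
    rw [this, map_add, map_smul, map_smul]; simp
  simp only [Function.comp_apply, hL (c * _), Fin.sum_univ_four, Matrix.cons_val]
  ring

lemma IsCenteredGaussianProcess.exists_map_eq (hG : IsCenteredGaussianProcess P X)
    {s : ℝ} (hs : 0 ≤ s) : ∃ v : NNReal, P.map (X s) = gaussianReal 0 v := by
  obtain ⟨v, hv⟩ := hG.2 1 ![s] ![1] (by simpa using hs)
  exact ⟨v, by simpa using hv⟩

lemma IsCenteredGaussianProcess.memLp_two (hG : IsCenteredGaussianProcess P X)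
    {s : ℝ} (hs : 0 ≤ s) : MemLp (X s) 2 P := by
  obtain ⟨v, hv⟩ := hG.exists_map_eq hs
  have := memLp_id_gaussianReal (μ := 0) (v := v) 2
  rw [← hv, memLp_map_measure_iff (by fun_prop) (hG.1 s).aemeasurable] at this
  exact this

lemma IsCenteredGaussianProcess.integral_eq_zero (hG : IsCenteredGaussianProcess P X)
    {s : ℝ} (hs : 0 ≤ s) : ∫ ω, X s ω ∂P = 0 := by
  obtain ⟨v, hv⟩ := hG.exists_map_eq hs
  have := integral_id_gaussianReal (μ := 0) (v := v)
  rwa [← hv, integral_map (hG.1 s).aemeasurable (by fun_prop)] at this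

variable [IsProbabilityMeasure P]

lemma IsCenteredGaussianProcess.covariance_eq (hG : IsCenteredGaussianProcess P X)
    {s t : ℝ} (hs : 0 ≤ s) (ht : 0 ≤ t) : cov[X s, X t; P] = ∫ ω, X s ω * X t ω ∂P := by
  rw [covariance_eq_sub (hG.memLp_two hs) (hG.memLp_two ht), hG.integral_eq_zero hs]
  simp

lemma IsCenteredGaussianProcess.covariance_increments (hG : IsCenteredGaussianProcess P X)
    {R : ℝ → ℝ → ℝ} (hR : ∀ s t : ℝ, 0 ≤ s → 0 ≤ t → R s t = ∫ ω, X s ω * X t ω ∂P)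
    {s₁ s₂ s₃ s₄ : ℝ} (h₁ : 0 ≤ s₁) (h₂ : 0 ≤ s₂) (h₃ : 0 ≤ s₃) (h₄ : 0 ≤ s₄) :
    cov[fun ω => X s₁ ω - X s₂ ω, fun ω => X s₃ ω - X s₄ ω; P]
      = R s₁ s₃ - R s₁ s₄ - R s₂ s₃ + R s₂ s₄ := by
  rw [covariance_fun_sub_fun_sub (hG.memLp_two h₁) (hG.memLp_two h₂) (hG.memLp_two h₃)
    (hG.memLp_two h₄), hG.covariance_eq h₁ h₃, hG.covariance_eq h₁ h₄, hG.covariance_eq h₂ h₃,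
    hG.covariance_eq h₂ h₄, hR _ _ h₁ h₃, hR _ _ h₁ h₄, hR _ _ h₂ h₃, hR _ _ h₂ h₄]

lemma IsCenteredGaussianProcess.integral_increment (hG : IsCenteredGaussianProcess P X)
    {s₁ s₂ : ℝ} (h₁ : 0 ≤ s₁) (h₂ : 0 ≤ s₂) (c : ℝ) :
    ∫ ω, c * (X s₁ ω - X s₂ ω) ∂P = 0 := by
  rw [integral_const_mul, integral_sub ((hG.memLp_two h₁).integrable one_le_two)
    ((hG.memLp_two h₂).integrable one_le_two), hG.integral_eq_zero h₁, hG.integral_eq_zero h₂]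
  simp

end CenteredGaussian

/-- A self-similar kernel along a geometric sequence is a power times a stationary sequence. -/
lemma selfSimilar_kernel_pow {R : ℝ → ℝ → ℝ} {ρ α : ℝ} (hα : 0 < α)
    (hss : ∀ c > (0 : ℝ), ∀ s > (0 : ℝ), ∀ t > (0 : ℝ),
      R (c * s) (c * t) = c ^ (2 * ρ) * R s t) (k m : ℕ) :
    R (α ^ k) (α ^ (k + m))
      = (α ^ ρ) ^ (2 * k + m) * ((α ^ m) ^ (-ρ) * R 1 (α ^ m)) := by
  have h := hss (α ^ k) (by positivity) 1 one_pos (α ^ m) (by positivity)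
  rw [mul_one, ← pow_add] at h
  rw [h, ← mul_assoc]
  congr 1
  rw [pow_add, mul_assoc, ← Real.rpow_natCast (α ^ ρ) m, ← Real.rpow_natCast (α ^ ρ) (2 * k),
    ← Real.rpow_mul hα.le, ← Real.rpow_mul hα.le, ← Real.rpow_natCast α k,
    ← Real.rpow_natCast α m, ← Real.rpow_mul hα.le, ← Real.rpow_mul hα.le, ← Real.rpow_add hα,
    ← Real.rpow_add hα]
  congr 1
  push_cast
  ring

lemma eventually_geometric_decay {f : ℝ → ℝ} {ρ η σ δ : ℝ} (hρ : 0 < ρ) (hη : 0 < η)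
    (hf : f =O[atTop] fun x : ℝ => Real.log x ^ (-η)) (hσ : 0 < σ) (hδ : 0 < δ) :
    ∀ᶠ α : ℝ in atTop, ∃ ε : ℝ, ε ≤ σ / 4 ∧ 10 * ε / σ + 2 / α ^ ρ ≤ δ ∧
      ∀ j : ℕ, 1 ≤ j → |f (α ^ j)| ≤ ε * (j : ℝ) ^ (-min η 1) := by
  obtain ⟨C, hC, hbound⟩ := hf.exists_pos
  obtain ⟨x₀, hx₀⟩ := eventually_atTop.1 hbound.bound
  have hε : Tendsto (fun α : ℝ => C * Real.log α ^ (-η)) atTop (nhds 0) := by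
    simpa using ((tendsto_rpow_neg_atTop hη).comp Real.tendsto_log_atTop).const_mul C
  have hB : Tendsto (fun α : ℝ => 10 * (C * Real.log α ^ (-η)) / σ + 2 / α ^ ρ) atTop (nhds 0) := by
    simpa using ((hε.const_mul 10).div_const σ).add ((tendsto_rpow_atTop hρ).const_div_atTop 2)
  filter_upwards [hε.eventually_le_const (by positivity : 0 < σ / 4), hB.eventually_le_const hδ,
    eventually_ge_atTop x₀, eventually_ge_atTop (Real.exp 1)] with α h1 h2 h3 h4
  have hα1 : 1 ≤ α := (Real.one_le_exp zero_le_one).trans h4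
  have hlog : 1 ≤ Real.log α := (Real.le_log_iff_exp_le (by linarith)).2 h4
  refine ⟨_, h1, h2, fun j hj => ?_⟩
  have hj1 : (1 : ℝ) ≤ j := by exact_mod_cast hj
  have hpow : α ≤ α ^ j := le_self_pow₀ hα1 (by omega)
  have := hx₀ (α ^ j) (h3.trans hpow)
  rw [Real.norm_eq_abs, Real.log_pow, Real.norm_of_nonneg (by positivity),
    Real.mul_rpow (by positivity) (by positivity)] at this
  refine this.trans ?_
  rw [mul_assoc, mul_comm ((j : ℝ) ^ (-η))]
  gcongr
  exact min_le_left _ _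

section Geometric

variable {Ω : Type*} [MeasurableSpace Ω] {P : Measure Ω} [IsProbabilityMeasure P]
  {X : ℝ → Ω → ℝ} {R : ℝ → ℝ → ℝ} {ρ α : ℝ}

/-- The unnormalized covariances of the increments of a self-similar process along `α ^ k`. -/
lemma IsCenteredGaussianProcess.covariance_geometric_increments
    (hG : IsCenteredGaussianProcess P X)
    (hR : ∀ s t : ℝ, 0 ≤ s → 0 ≤ t → R s t = ∫ ω, X s ω * X t ω ∂P)
    (hss : ∀ c > (0 : ℝ), ∀ s > (0 : ℝ), ∀ t > (0 : ℝ),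
      R (c * s) (c * t) = c ^ (2 * ρ) * R s t) (hα : 0 < α)
    {h : ℕ → ℝ} (hh : ∀ m, h m = (α ^ m) ^ (-ρ) * R 1 (α ^ m)) (k m : ℕ) :
    cov[fun ω => X (α ^ (k + 1)) ω - X (α ^ k) ω,
        fun ω => X (α ^ (k + m + 1 + 1)) ω - X (α ^ (k + m + 1)) ω; P]
      = (α ^ ρ) ^ (2 * k + m + 1) *
        (((α ^ ρ) ^ 2 + 1) * h (m + 1) - α ^ ρ * h m - α ^ ρ * h (m + 2)) := by
  have hp : ∀ k : ℕ, 0 ≤ α ^ k := fun k => by positivity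
  have key : ∀ k m, R (α ^ k) (α ^ (k + m)) = (α ^ ρ) ^ (2 * k + m) * h m := fun k m => by
    rw [hh]; exact selfSimilar_kernel_pow hα hss k m
  have e1 := key (k + 1) (m + 1)
  have e2 := key (k + 1) m
  have e3 := key k (m + 2)
  have e4 := key k (m + 1)
  rw [hG.covariance_increments hR (hp _) (hp _) (hp _) (hp _),
    show k + m + 1 + 1 = k + 1 + (m + 1) by ring, e1, show k + m + 1 = k + 1 + m by ring, e2,
    show k + 1 + (m + 1) = k + (m + 2) by ring, e3, show k + 1 + m = k + (m + 1) by ring, e4]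
  ring

lemma IsCenteredGaussianProcess.variance_geometric_increment
    (hG : IsCenteredGaussianProcess P X)
    (hR : ∀ s t : ℝ, 0 ≤ s → 0 ≤ t → R s t = ∫ ω, X s ω * X t ω ∂P)
    (hss : ∀ c > (0 : ℝ), ∀ s > (0 : ℝ), ∀ t > (0 : ℝ),
      R (c * s) (c * t) = c ^ (2 * ρ) * R s t) (hα : 0 < α)
    {h : ℕ → ℝ} (hh : ∀ m, h m = (α ^ m) ^ (-ρ) * R 1 (α ^ m)) (k : ℕ) :
    variance (fun ω => X (α ^ (k + 1)) ω - X (α ^ k) ω) P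
      = ((α ^ ρ) ^ k) ^ 2 * (((α ^ ρ) ^ 2 + 1) * h 0 - 2 * α ^ ρ * h 1) := by
  have hp : ∀ k : ℕ, 0 ≤ α ^ k := fun k => by positivity
  have key : ∀ k m, R (α ^ k) (α ^ (k + m)) = (α ^ ρ) ^ (2 * k + m) * h m := fun k m => by
    rw [hh]; exact selfSimilar_kernel_pow hα hss k m
  have e1 := key (k + 1) 0
  have e2 := key k 1
  have e3 := key k 0
  have hsymm : R (α ^ (k + 1)) (α ^ k) = R (α ^ k) (α ^ (k + 1)) := by
    rw [hR _ _ (hp _) (hp _), hR _ _ (hp _) (hp _)]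
    simp only [mul_comm]
  simp only [add_zero] at e1 e3
  have hm := hG.1
  rw [← covariance_self (by fun_prop), hG.covariance_increments hR (hp _) (hp _) (hp _) (hp _),
    hsymm, e1, e2, e3]
  ring

/-- The standardized increments along `α ^ k` have correlations depending only on the lag. -/
lemma IsCenteredGaussianProcess.covariance_standardized_increments
    (hG : IsCenteredGaussianProcess P X)
    (hR : ∀ s t : ℝ, 0 ≤ s → 0 ≤ t → R s t = ∫ ω, X s ω * X t ω ∂P)
    (hss : ∀ c > (0 : ℝ), ∀ s > (0 : ℝ), ∀ t > (0 : ℝ),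
      R (c * s) (c * t) = c ^ (2 * ρ) * R s t) (hα : 0 < α)
    {h : ℕ → ℝ} (hh : ∀ m, h m = (α ^ m) ^ (-ρ) * R 1 (α ^ m))
    (hD : 0 < ((α ^ ρ) ^ 2 + 1) * h 0 - 2 * α ^ ρ * h 1) {γ : ℕ → ℝ}
    (hγ : ∀ k, γ k = variance (fun ω => X (α ^ (k + 1)) ω - X (α ^ k) ω) P) (k m : ℕ) :
    cov[fun ω => (√(γ (k + m + 1)))⁻¹ * (X (α ^ (k + m + 1 + 1)) ω - X (α ^ (k + m + 1)) ω),
        fun ω => (√(γ k))⁻¹ * (X (α ^ (k + 1)) ω - X (α ^ k) ω); P]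
      = (((α ^ ρ) ^ 2 + 1) * h (m + 1) - α ^ ρ * h m - α ^ ρ * h (m + 2))
        / (((α ^ ρ) ^ 2 + 1) * h 0 - 2 * α ^ ρ * h 1) := by
  have hB : 0 < α ^ ρ := Real.rpow_pos_of_pos hα ρ
  rw [covariance_const_mul_left, covariance_const_mul_right, covariance_comm,
    hG.covariance_geometric_increments hR hss hα hh, hγ, hγ,
    hG.variance_geometric_increment hR hss hα hh, hG.variance_geometric_increment hR hss hα hh,
    Real.sqrt_mul (by positivity), Real.sqrt_mul (by positivity), Real.sqrt_sq (by positivity),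
    Real.sqrt_sq (by positivity)]
  set D := ((α ^ ρ) ^ 2 + 1) * h 0 - 2 * α ^ ρ * h 1
  set N := ((α ^ ρ) ^ 2 + 1) * h (m + 1) - α ^ ρ * h m - α ^ ρ * h (m + 2)
  have hs : √D * √D = D := Real.mul_self_sqrt hD.le
  have hs0 : 0 < √D := Real.sqrt_pos.2 hD
  calc _ = ((α ^ ρ) ^ (k + m + 1) * (α ^ ρ) ^ k)⁻¹ * (α ^ ρ) ^ (2 * k + m + 1) * (N / (√D * √D)) := by
        field_simp
    _ = N / D := by
        rw [hs, ← pow_add, show k + m + 1 + k = 2 * k + m + 1 by ring, inv_mul_cancel₀ (by positivity),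
          one_mul]

end Geometric

section LevelCrossing

variable {Ω : Type*} [MeasurableSpace Ω] {P : Measure Ω} [IsProbabilityMeasure P]

/-- Level-crossing events of a standardized Gaussian sequence with decaying correlations. -/
lemma sum_sum_measureReal_inter_isBigO {U : ℕ → Ω → ℝ} {a : ℕ → ℝ} {η L : ℝ} {A : ℕ → Set Ω}
    (hη : 0 < η) (hη1 : η ≤ 1) (hL : 1 ≤ L)
    (hU : ∀ k l, HasGaussianLaw (fun ω => (U k ω, U l ω)) P) (hU0 : ∀ k, ∫ ω, U k ω ∂P = 0)
    (hU1 : ∀ k, variance (U k) P = 1)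
    (hcov : ∀ k m, |cov[U (k + m + 1), U k; P]| ≤ η / 4 * ((m + 1 : ℕ) : ℝ) ^ (-η))
    (ha : ∀ k : ℕ, a k = √(2 * Real.log (((k + 1 : ℕ) : ℝ) * L)))
    (hA : ∀ k, A k = {ω | a k < U k ω}) :
    (fun n : ℕ => ∑ k ∈ Finset.Icc 1 n, ∑ l ∈ Finset.Icc 1 n,
          (P.real (A k ∩ A l) - P.real (A k) * P.real (A l)))
        =O[atTop] fun n : ℕ => Real.sqrt (Real.log n) := by
  have harg : ∀ k : ℕ, ((k + 1 : ℕ) : ℝ) ≤ ((k + 1 : ℕ) : ℝ) * L := fun k =>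
    le_mul_of_one_le_right (by positivity) hL
  have hlog0 : ∀ k : ℕ, 0 ≤ Real.log (((k + 1 : ℕ) : ℝ) * L) := fun k =>
    Real.log_nonneg (le_trans (by simp) (harg k))
  have ha2 : ∀ k, a k ^ 2 = 2 * Real.log (((k + 1 : ℕ) : ℝ) * L) := fun k => by
    rw [ha, Real.sq_sqrt (by linarith [hlog0 k])]
  have ha0 : ∀ k, 0 ≤ a k := fun k => by rw [ha]; positivity
  have hmono : ∀ k m, a k ≤ a (k + m) := fun k m => by
    rw [ha, ha]
    refine Real.sqrt_le_sqrt (mul_le_mul_of_nonneg_left (Real.log_le_log ?_ ?_) zero_le_two)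
    · positivity
    · gcongr; omega
  set p := 1 - η / 4 with hp
  have hdiag : ∀ k, 1 ≤ k → P.real (A k) ≤ 1 / (((k : ℝ) + 1) * √(Real.log (k + 1))) := by
    intro k hk
    have hk1 : (1 : ℝ) ≤ k := by exact_mod_cast hk
    have hlogk : 0 < Real.log ((k : ℝ) + 1) := Real.log_pos (by linarith)
    have hle : Real.log ((k : ℝ) + 1) ≤ Real.log (((k + 1 : ℕ) : ℝ) * L) :=
      Real.log_le_log (by linarith) (by simpa using harg k)
    have hle' : √(Real.log (k + 1)) ≤ a k := by
      rw [ha]; exact Real.sqrt_le_sqrt (by linarith [hlog0 k])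
    have hsq : 0 < √(Real.log ((k : ℝ) + 1)) := Real.sqrt_pos.2 hlogk
    have e1 : P.real (A k) = (gaussianReal 0 1).real (Set.Ioi (a k)) := by
      rw [← (hU k k).fst.map_eq_standard (hU0 k) (hU1 k),
        map_measureReal_apply_of_aemeasurable (hU k k).fst.aemeasurable measurableSet_Ioi, hA]
      rfl
    rw [e1, ← div_div]
    refine (gaussianReal_Ioi_le (hsq.trans_le hle')).trans ?_
    gcongr
    rw [ha2, show -(2 * Real.log (((k + 1 : ℕ) : ℝ) * L)) / 2
      = -Real.log (((k + 1 : ℕ) : ℝ) * L) by ring, Real.exp_neg, Real.exp_log (by positivity),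
      one_div]
    exact inv_anti₀ (by positivity) (by simpa using harg k)
  have hoff : ∀ k m : ℕ, 1 ≤ k → 1 ≤ m →
      |P.real (A k ∩ A (k + m)) - P.real (A k) * P.real (A (k + m))|
        ≤ (k : ℝ) ^ (-(p * (1 + η / 2))) * (m : ℝ) ^ (-(η + p * (1 - η / 2))) := by
    intro k m hk hm
    obtain ⟨m, rfl⟩ : ∃ j, m = j + 1 := ⟨m - 1, by omega⟩
    have hk1 : (1 : ℝ) ≤ k := by exact_mod_cast hk
    have hm1 : (1 : ℝ) ≤ ((m + 1 : ℕ) : ℝ) := by exact_mod_cast hm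
    have hc := hcov k m
    set r := cov[U (k + m + 1), U k; P] with hr
    have hw1 : ((m + 1 : ℕ) : ℝ) ^ (-η) ≤ 1 :=
      Real.rpow_le_one_of_one_le_of_nonpos hm1 (by linarith)
    have hr4 : |r| ≤ η / 4 := hc.trans (mul_le_of_le_one_right (by linarith) hw1)
    have hmain := (hU (k + m + 1) k).abs_measureReal_inter_sub_le (hU0 _) (hU0 _) (hU1 _) (hU1 _)
      (by rw [← hr]; linarith) (ha0 k) (hmono k (m + 1))
    rw [← hr, ha2, ha2] at hmain
    have hset : {ω | a (k + (m + 1)) < U (k + m + 1) ω ∧ a k < U k ω} = A k ∩ A (k + (m + 1)) := by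
      rw [hA, hA, Set.inter_comm]; rfl
    rw [hset, mul_comm (P.real _), ← hA k,
      show {ω | a (k + (m + 1)) < U (k + m + 1) ω} = A (k + (m + 1)) from (hA _).symm] at hmain
    refine hmain.trans ?_
    have hexp := exp_neg_le_rpow_mul_rpow (k := ((k : ℝ) + ((m + 1 : ℕ) : ℝ))) (l := k)
      (x := ((k + (m + 1) + 1 : ℕ) : ℝ) * L) (y := ((k + 1 : ℕ) : ℝ) * L) (q := |r|) (p := p)
      (by linarith) hk1 (le_trans (by push_cast; linarith) (harg _))
      (le_trans (by push_cast; linarith) (harg _)) (abs_nonneg r) (by linarith)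
    have hsep := rpow_mul_rpow_add_le (k := k) (m := ((m + 1 : ℕ) : ℝ)) (p := p) (θ := η / 2)
      hk1 hm1 (by linarith) (by linarith) (by linarith)
    calc _ ≤ 1 * ((m + 1 : ℕ) : ℝ) ^ (-η) *
          ((k : ℝ) ^ (-(p * (1 + η / 2))) * ((m + 1 : ℕ) : ℝ) ^ (-(p * (1 - η / 2)))) := by
          refine mul_le_mul ?_ (hexp.trans ((mul_comm _ _).trans_le hsep)) (Real.exp_nonneg _)
            (by positivity)
          nlinarith [show 0 ≤ ((m + 1 : ℕ) : ℝ) ^ (-η) by positivity]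
      _ = _ := by
          rw [show -(η + p * (1 - η / 2)) = -η + -(p * (1 - η / 2)) by ring,
            Real.rpow_add (by positivity)]
          ring
  have hsum := abs_sum_sum_le_of_summable
    (c := fun k l => P.real (A k ∩ A l) - P.real (A k) * P.real (A l))
    (u := fun k : ℕ => (k : ℝ) ^ (-(p * (1 + η / 2))))
    (v := fun m : ℕ => (m : ℝ) ^ (-(η + p * (1 - η / 2))))
    (q := fun k : ℕ => 1 / (((k : ℝ) + 1) * √(Real.log (k + 1))))
    (fun k l => by simp only [Set.inter_comm, mul_comm])
    (Real.summable_nat_rpow.2 (by nlinarith)) (Real.summable_nat_rpow.2 (by nlinarith))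
    (fun k => by positivity) (fun k => by positivity)
    (fun k hk => by
      have h0 : 0 ≤ P.real (A k) := measureReal_nonneg
      have h1 : P.real (A k) ≤ 1 := measureReal_le_one
      simp only [Set.inter_self]
      rw [abs_of_nonneg (by nlinarith)]
      nlinarith [hdiag k hk]) hoff
  set K := 2 * ((∑' k : ℕ, (k : ℝ) ^ (-(p * (1 + η / 2))))
    * ∑' m : ℕ, (m : ℝ) ^ (-(η + p * (1 - η / 2)))) with hK
  have hK0 : 0 ≤ K := by
    have h1 : 0 ≤ ∑' k : ℕ, (k : ℝ) ^ (-(p * (1 + η / 2))) := tsum_nonneg fun k => by positivity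
    have h2 : 0 ≤ ∑' m : ℕ, (m : ℝ) ^ (-(η + p * (1 - η / 2))) :=
      tsum_nonneg fun k => by positivity
    positivity
  refine IsBigO.of_bound (4 + K) ?_
  filter_upwards [eventually_ge_atTop 3] with n hn
  have hn3 : (3 : ℝ) ≤ n := by exact_mod_cast hn
  have hone : 1 ≤ √(Real.log n) := by
    rw [Real.one_le_sqrt, Real.le_log_iff_exp_le (by linarith)]
    linarith [Real.exp_one_lt_d9]
  have hlogn : √(Real.log ((n : ℝ) + 1)) ≤ 2 * √(Real.log n) := by
    have : Real.log ((n : ℝ) + 1) ≤ 2 ^ 2 * Real.log n := by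
      rw [show (2 : ℝ) ^ 2 * Real.log n = Real.log ((n : ℝ) ^ 4) by rw [Real.log_pow]; norm_num]
      refine Real.log_le_log (by linarith) ?_
      nlinarith [pow_le_pow_left₀ (by norm_num) hn3 3]
    refine (Real.sqrt_le_sqrt this).trans_eq ?_
    rw [Real.sqrt_mul (by norm_num), Real.sqrt_sq (by norm_num)]
  rw [Real.norm_eq_abs, Real.norm_of_nonneg (Real.sqrt_nonneg _)]
  refine (hsum n).trans ?_
  nlinarith [sum_inv_mul_sqrt_log_le n]

end LevelCrossing

/-- Lemma 6: under assumptions (i) and (ii), for sufficiently large `α > 1`, with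
`t_k = α^k`, `a_k = (2 log log t_{k+1})^{1/2}`, `γ_k = Var(X(t_{k+1}) - X(t_k))` and
`A_k = {X(t_{k+1}) - X(t_k) > γ_k^{1/2} a_k}`, one has
`∑_{k=1}^n ∑_{l=1}^n (P(A_k ∩ A_l) - P(A_k)P(A_l)) = O(√(log n))` as `n → ∞`. -/
theorem covariance_sum_bigO {Ω : Type*} [MeasurableSpace Ω] (P : Measure Ω)
    [IsProbabilityMeasure P] (X : ℝ → Ω → ℝ) (R : ℝ → ℝ → ℝ) (ρ η : ℝ)
    (hρ : 0 < ρ) (hη : 0 < η)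
    (hGauss : IsCenteredGaussianProcess P X)
    (hR : ∀ s t : ℝ, 0 ≤ s → 0 ≤ t → R s t = ∫ ω, X s ω * X t ω ∂P)
    (hss : ∀ c > (0 : ℝ), ∀ s > (0 : ℝ), ∀ t > (0 : ℝ),
      R (c * s) (c * t) = c ^ (2 * ρ) * R s t)
    (hdecay : (fun x : ℝ => x ^ (-ρ) * R 1 x) =O[atTop]
      fun x : ℝ => Real.log x ^ (-η))
    (t : ℝ → ℕ → ℝ) (ht : ∀ (α : ℝ) (k : ℕ), t α k = α ^ k)
    (a : ℝ → ℕ → ℝ)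
    (haa : ∀ (α : ℝ) (k : ℕ),
      a α k = Real.sqrt (2 * Real.log (Real.log (t α (k + 1)))))
    (γ : ℝ → ℕ → ℝ)
    (hγ : ∀ (α : ℝ) (k : ℕ),
      γ α k = variance (fun ω => X (t α (k + 1)) ω - X (t α k) ω) P)
    (A : ℝ → ℕ → Set Ω)
    (hA : ∀ (α : ℝ) (k : ℕ),
      A α k = {ω | Real.sqrt (γ α k) * a α k < X (t α (k + 1)) ω - X (t α k) ω}) :
    ∃ α₀ > (1 : ℝ), ∀ α ≥ α₀,
      (fun n : ℕ => ∑ k ∈ Finset.Icc 1 n, ∑ l ∈ Finset.Icc 1 n,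
          ((P (A α k ∩ A α l)).toReal - (P (A α k)).toReal * (P (A α l)).toReal))
        =O[atTop] fun n : ℕ => Real.sqrt (Real.log n) := by
  have ht' : t = fun α k => α ^ k := by ext α k; exact ht α k
  subst ht'
  have h11 : 0 ≤ R 1 1 := by
    rw [hR 1 1 zero_le_one zero_le_one]
    exact integral_nonneg fun ω => mul_self_nonneg _
  rcases h11.eq_or_lt with h0 | h0
  · refine ⟨2, one_lt_two, fun α hα => ?_⟩
    have hz : ∀ s : ℝ, 0 < s → X s =ᵐ[P] 0 := fun s hs => by
      have h1 := hss s hs 1 one_pos 1 one_pos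
      rw [← h0, mul_zero, mul_one, hR s s hs.le hs.le] at h1
      have hint : Integrable (fun ω => X s ω * X s ω) P :=
        (hGauss.memLp_two hs.le).integrable_mul (hGauss.memLp_two hs.le)
      filter_upwards [(integral_eq_zero_iff_of_nonneg (fun ω => mul_self_nonneg _) hint).1 h1]
        with ω hω
      simpa using hω
    have hA0 : ∀ k, P (A α k) = 0 := fun k => by
      rw [hA]
      have : ∀ᵐ ω ∂P, ¬ (√(γ α k) * a α k < X (α ^ (k + 1)) ω - X (α ^ k) ω) := by
        filter_upwards [hz (α ^ (k + 1)) (by positivity), hz (α ^ k) (by positivity)] with ω h1 h2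
        rw [h1, h2, haa]
        simp only [Pi.zero_apply, sub_self, not_lt]
        positivity
      simpa only [not_not] using ae_iff.1 this
    have hA1 : ∀ k l, P (A α k ∩ A α l) = 0 := fun k l =>
      measure_mono_null Set.inter_subset_left (hA0 k)
    simp [hA0, hA1, isBigO_zero]
  have hη' : 0 < min η 1 := lt_min hη one_pos
  have hev := (eventually_geometric_decay hρ hη hdecay h0
    (by positivity : 0 < min η 1 / 4)).and (eventually_ge_atTop (Real.exp 1))
  obtain ⟨α₁, hα₁⟩ := eventually_atTop.1 hev
  refine ⟨max α₁ 2, lt_max_of_lt_right one_lt_two, fun α hα => ?_⟩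
  obtain ⟨⟨ε, hε1, hε2, hh⟩, hαe⟩ := hα₁ α ((le_max_left _ _).trans hα)
  have hα2 : 2 ≤ α := (le_max_right _ _).trans hα
  have hαpos : 0 < α := by linarith
  have hB : 1 ≤ α ^ ρ := Real.one_le_rpow (by linarith) hρ.le
  set h : ℕ → ℝ := fun m => (α ^ m) ^ (-ρ) * R 1 (α ^ m) with hdef
  have hh0 : h 0 = R 1 1 := by simp [hdef]
  rw [← hh0] at h0 hε1 hε2
  have hD : 0 < ((α ^ ρ) ^ 2 + 1) * h 0 - 2 * α ^ ρ * h 1 := by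
    have h1 : h 1 ≤ h 0 / 4 := (le_abs_self _).trans
      ((hh 1 le_rfl).trans (by simpa using hε1))
    nlinarith [mul_le_mul_of_nonneg_left h1 (by linarith : 0 ≤ 2 * α ^ ρ),
      mul_nonneg (sq_nonneg (α ^ ρ - 1)) h0.le]
  have hγpos : ∀ k, 0 < γ α k := fun k => by
    rw [hγ, hGauss.variance_geometric_increment hR hss hαpos (fun m => rfl)]
    positivity
  have hp : ∀ k : ℕ, 0 ≤ α ^ k := fun k => by positivity
  refine sum_sum_measureReal_inter_isBigO (P := P) (η := min η 1) (L := Real.log α) (a := a α)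
    (U := fun k ω => (√(γ α k))⁻¹ * (X (α ^ (k + 1)) ω - X (α ^ k) ω)) hη' (min_le_right _ _)
    ((Real.le_log_iff_exp_le hαpos).2 hαe)
    (fun k l => hGauss.hasGaussianLaw_increments (hp _) (hp _) (hp _) (hp _) _ _)
    (fun k => hGauss.integral_increment (hp _) (hp _) _) (fun k => ?_) (fun k m => ?_)
    (fun k => by rw [haa, Real.log_pow]) (fun k => ?_)
  · rw [variance_const_mul, ← hγ, inv_pow, Real.sq_sqrt (hγpos k).le,
      inv_mul_cancel₀ (hγpos k).ne']
  · rw [hGauss.covariance_standardized_increments hR hss hαpos (fun m => rfl) hD (hγ α)]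
    refine (abs_increment_correlation_le hB h0 hη'.le (min_le_right _ _) hε1 hh m).trans ?_
    gcongr
  · rw [hA]
    ext ω
    simp only [Set.mem_ofPred_eq]
    rw [inv_mul_eq_div, lt_div_iff₀ (Real.sqrt_pos.2 (hγpos k)), mul_comm]
end
end

section
/- Let β > −1/2 and 0 ≤ γ < 1, and define R(s,t) = ∫_0^{min(s,t)} (s−u)^β (t−u)^β u^{−γ} du for s, t > 0 (the covariance kernel of the generalized Riemann–Liouville fractional Brownian motion). Then with ρ = β − γ/2 + 1/2 one has R(cs,ct) = c^{2ρ} R(s,t) for all c > 0 and s,t > 0, and the function h(x) = x^{−ρ} R(1,x), x ≥ 1, satisfies h(x) = O(x^{−(1−γ)/2}) as x → ∞. -/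
open MeasureTheory Filter Asymptotics

noncomputable section

/-- The real Beta integrand `(1 - u) ^ β * u ^ (-γ)` is integrable on `(0, 1)`. -/
theorem integrableOn_one_sub_rpow_mul_rpow_neg {β γ : ℝ} (hβ : -1 < β) (hγ : γ < 1) :
    IntegrableOn (fun u : ℝ => (1 - u) ^ β * u ^ (-γ)) (Set.Ioo 0 1) := by
  have h := Complex.betaIntegral_convergent (u := ((1 - γ : ℝ) : ℂ)) (v := ((β + 1 : ℝ) : ℂ))
    (by rw [Complex.ofReal_re]; linarith) (by rw [Complex.ofReal_re]; linarith)
  rw [intervalIntegrable_iff_integrableOn_Ioo_of_le zero_le_one] at h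
  refine IntegrableOn.congr_fun h.re (fun u hu => ?_) measurableSet_Ioo
  have e : (u : ℂ) ^ (((1 - γ : ℝ) : ℂ) - 1) * (1 - (u : ℂ)) ^ (((β + 1 : ℝ) : ℂ) - 1)
      = (((1 - u) ^ β * u ^ (-γ) : ℝ) : ℂ) := by
    rw [Complex.ofReal_mul, Complex.ofReal_cpow (by linarith [hu.2]),
      Complex.ofReal_cpow hu.1.le, mul_comm]
    push_cast
    ring_nf
  simp only [e]
  exact RCLike.ofReal_re (K := ℂ) _

/-- Linear change of variables for an integral over `(0, a)`. -/
theorem setIntegral_Ioo_zero_mul_left (f : ℝ → ℝ) {c a : ℝ} (hc : 0 < c) (ha : 0 ≤ a) :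
    ∫ u in Set.Ioo 0 (c * a), f u = c * ∫ u in Set.Ioo 0 a, f (c * u) := by
  rw [← integral_Ioc_eq_integral_Ioo, ← integral_Ioc_eq_integral_Ioo,
    ← intervalIntegral.integral_of_le ha, ← intervalIntegral.integral_of_le (by positivity),
    intervalIntegral.mul_integral_comp_mul_left, mul_zero]

/-- For `0 < u < 1` and `2 ≤ x`, the power `(x - u) ^ β` is comparable to `x ^ β`. -/
theorem sub_rpow_le_two_rpow_abs_mul (β : ℝ) {x u : ℝ} (hx : 2 ≤ x) (hu0 : 0 < u) (hu1 : u < 1) :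
    (x - u) ^ β ≤ 2 ^ |β| * x ^ β := by
  rcases le_total 0 β with h | h
  · calc (x - u) ^ β ≤ x ^ β := Real.rpow_le_rpow (by linarith) (by linarith) h
      _ ≤ 2 ^ |β| * x ^ β := le_mul_of_one_le_left (Real.rpow_nonneg (by linarith) _)
          (Real.one_le_rpow one_le_two (abs_nonneg β))
  · calc (x - u) ^ β ≤ (2⁻¹ * x) ^ β :=
          Real.rpow_le_rpow_of_nonpos (by linarith) (by linarith) h
      _ = 2 ^ |β| * x ^ β := by
          rw [Real.mul_rpow (by norm_num) (by linarith), abs_of_nonpos h,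
            Real.inv_rpow zero_le_two, Real.rpow_neg zero_le_two]

/-- Example (b): the covariance kernel
`R(s,t) = ∫_0^{min s t} (s-u)^β (t-u)^β u^{-γ} du` of the generalized
Riemann–Liouville fractional Brownian motion (`β > -1/2`, `0 ≤ γ < 1`) is self-similar
with exponent `ρ = β - γ/2 + 1/2`, and `h(x) = x^{-ρ} R(1,x)` satisfies
`h(x) = O(x^{-(1-γ)/2})` as `x → ∞`. -/
theorem riemann_liouville_kernel_selfsimilar_and_decay (β γ : ℝ)
    (hβ : -(1 / 2) < β) (hγ0 : 0 ≤ γ) (hγ1 : γ < 1)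
    (ρ : ℝ) (hρ : ρ = β - γ / 2 + 1 / 2)
    (R : ℝ → ℝ → ℝ)
    (hR : ∀ s t : ℝ, 0 < s → 0 < t →
      R s t = ∫ u in Set.Ioo (0 : ℝ) (min s t),
        (s - u) ^ β * (t - u) ^ β * u ^ (-γ)) :
    (∀ c > (0 : ℝ), ∀ s > (0 : ℝ), ∀ t > (0 : ℝ),
        R (c * s) (c * t) = c ^ (2 * ρ) * R s t) ∧
    ((fun x : ℝ => x ^ (-ρ) * R 1 x) =O[atTop]
      fun x : ℝ => x ^ (-(1 - γ) / 2)) := by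
  constructor
  · intro c hc s hs t ht
    rw [hR _ _ (mul_pos hc hs) (mul_pos hc ht), hR s t hs ht, ← mul_min_of_nonneg _ _ hc.le,
      setIntegral_Ioo_zero_mul_left _ hc (lt_min hs ht).le, ← integral_const_mul,
      ← integral_const_mul]
    refine setIntegral_congr_fun measurableSet_Ioo fun u hu => ?_
    have hus : 0 ≤ s - u := by linarith [hu.2, min_le_left s t]
    have hut : 0 ≤ t - u := by linarith [hu.2, min_le_right s t]
    have hexp : c ^ (2 * ρ) = c * (c ^ β * c ^ β * c ^ (-γ)) := by
      rw [show 2 * ρ = 1 + (β + β + -γ) by linarith, Real.rpow_add hc, Real.rpow_add hc,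
        Real.rpow_add hc, Real.rpow_one]
    simp only [← mul_sub]
    rw [Real.mul_rpow hc.le hus, Real.mul_rpow hc.le hut, Real.mul_rpow hc.le hu.1.le, hexp]
    ring
  · have hint := integrableOn_one_sub_rpow_mul_rpow_neg (by linarith : -1 < β) hγ1
    refine IsBigO.of_bound (2 ^ |β| * ∫ u in Set.Ioo (0 : ℝ) 1, (1 - u) ^ β * u ^ (-γ)) ?_
    filter_upwards [eventually_ge_atTop 2] with x hx
    have hx0 : 0 < x := by linarith
    have hbound : ‖R 1 x‖ ≤
        2 ^ |β| * x ^ β * ∫ u in Set.Ioo (0 : ℝ) 1, (1 - u) ^ β * u ^ (-γ) := by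
      rw [hR 1 x one_pos hx0, min_eq_left (by linarith), ← integral_const_mul]
      refine norm_integral_le_of_norm_le (hint.const_mul _) ?_
      filter_upwards [ae_restrict_mem measurableSet_Ioo] with u hu
      have h1 : 0 ≤ (1 - u) ^ β := Real.rpow_nonneg (by linarith [hu.2]) _
      have h2 : 0 ≤ u ^ (-γ) := Real.rpow_nonneg hu.1.le _
      have h3 : 0 ≤ (x - u) ^ β := Real.rpow_nonneg (by linarith [hu.2]) _
      rw [Real.norm_of_nonneg (by positivity), mul_comm ((1 - u) ^ β), mul_assoc]
      exact mul_le_mul_of_nonneg_right (sub_rpow_le_two_rpow_abs_mul β hx hu.1 hu.2)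
        (by positivity)
    have hexp : x ^ (-(1 - γ) / 2) = x ^ (-ρ) * x ^ β := by
      rw [← Real.rpow_add hx0]
      congr 1
      linarith
    rw [norm_mul, Real.norm_of_nonneg (Real.rpow_nonneg hx0.le (-ρ)),
      Real.norm_of_nonneg (Real.rpow_nonneg hx0.le _), hexp]
    refine (mul_le_mul_of_nonneg_left hbound (Real.rpow_nonneg hx0.le _)).trans_eq ?_
    ring
end
end
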